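/- arXiv:1907.06448 — 2 statements merged into one kernel-verified Lean document; each statement's English description precedes it below -/
import Mathlib

section
/- Let Γ be an Artin algebra with dominant dimension at least 2, i.e., there exists an exact sequence 0 → Γ → J_0 → J_1 of left Γ-modules with J_0, J_1 projective-injective. Let T be a finitely generated Γ-module that is both projective and injective and such that every projective-injective finitely generated Γ-module lies in add T (a maximal projective-injective direct summand of Γ). Let A = End_Γ(T) and let M = T viewed as a left A-module. Then M is a generator-cogenerator over A, and the canonical ring homomorphism Γ → End_A(T) is an isomorphism. -/
open CategoryTheory

universe u

noncomputable instance hasExtModuleCat (A : Type u) [Ring A] : HasExt.{u+1} (ModuleCat.{u} A) :=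
  letI := HasDerivedCategory.standard (ModuleCat.{u} A)
  hasExt_of_hasDerivedCategory _

/-- `Ext^i_A(X, Y) = 0`. -/
def ExtVanishes (A : Type u) [Ring A] (X Y : Type u) [AddCommGroup X] [Module A X]
    [AddCommGroup Y] [Module A Y] (i : ℕ) : Prop :=
  Subsingleton (Abelian.Ext (ModuleCat.of A X) (ModuleCat.of A Y) i)

/-- `X ∈ add M`: `X` is a direct summand of a finite direct sum of copies of `M`. -/
def InAdd (Λ : Type u) [Ring Λ] (M : Type u) [AddCommGroup M] [Module Λ M]
    (X : Type u) [AddCommGroup X] [Module Λ X] : Prop :=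
  ∃ (k : ℕ) (ι : X →ₗ[Λ] (Fin k → M)) (π : (Fin k → M) →ₗ[Λ] X), π ∘ₗ ι = LinearMap.id

/-- `I`-domdim of `Y` is at least `t`: there is an exact sequence
`0 → Y → J_0 → ⋯ → J_{t-1}` with all `J_i ∈ add I`. -/
def IDomdimGE (Λ : Type u) [Ring Λ] (I : Type u) [AddCommGroup I] [Module Λ I]
    (Y : Type u) [AddCommGroup Y] [Module Λ Y] (t : ℕ) : Prop :=
  ∃ (J : ℕ → ModuleCat.{u} Λ) (g : Y →ₗ[Λ] J 0) (f : ∀ i, (J i : Type u) →ₗ[Λ] J (i+1)),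
    (∀ i < t, InAdd Λ I (J i)) ∧
    (1 ≤ t → Function.Injective g) ∧
    (2 ≤ t → Function.Exact g (f 0)) ∧
    (∀ i, i + 3 ≤ t → Function.Exact (f i) (f (i+1)))

/-- The projective dimension of `N` is at most `m`: there is a projective resolution
`0 → P_m → ⋯ → P_0 → N → 0`. -/
def ProjDimLE (Λ : Type u) [Ring Λ] (N : Type u) [AddCommGroup N] [Module Λ N] (m : ℕ) : Prop :=
  ∃ (P : ℕ → ModuleCat.{u} Λ) (f : ∀ i, (P (i+1) : Type u) →ₗ[Λ] P i) (g : (P 0 : Type u) →ₗ[Λ] N),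
    (∀ i, Module.Projective Λ (P i)) ∧
    (∀ i, m < i → Subsingleton (P i)) ∧
    Function.Surjective g ∧ Function.Exact (f 0) g ∧
    (∀ i, Function.Exact (f (i+1)) (f i))

/-- The injective dimension of `N` is at most `m`: there is an injective coresolution
`0 → N → J_0 → ⋯ → J_m → 0`. -/
def InjDimLE (Λ : Type u) [Ring Λ] (N : Type u) [AddCommGroup N] [Module Λ N] (m : ℕ) : Prop :=
  ∃ (J : ℕ → ModuleCat.{u} Λ) (g : N →ₗ[Λ] J 0) (f : ∀ i, (J i : Type u) →ₗ[Λ] J (i+1)),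
    (∀ i, Module.Injective Λ (J i)) ∧
    (∀ i, m < i → Subsingleton (J i)) ∧
    Function.Injective g ∧ Function.Exact g (f 0) ∧
    (∀ i, Function.Exact (f i) (f (i+1)))

/-- `M` is a cogenerator: every finitely generated module embeds into a finite
direct sum of copies of `M`. -/
def IsCogenerator (A : Type u) [Ring A] (M : Type u) [AddCommGroup M] [Module A M] : Prop :=
  ∀ (X : Type u) [AddCommGroup X] [Module A X], Module.Finite A X →
    ∃ (k : ℕ) (f : X →ₗ[A] (Fin k → M)), Function.Injective f

/-- `M`-codim `A ≤ m`: there is an exact sequence `0 → A → M_0 → ⋯ → M_m → 0` with all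
`M_i ∈ add M` which stays exact after applying `Hom_A(-, M)`. -/
def MCodimLE (A : Type u) [Ring A] (M : Type u) [AddCommGroup M] [Module A M] (m : ℕ) : Prop :=
  ∃ (C : ℕ → ModuleCat.{u} A) (g : A →ₗ[A] C 0) (f : ∀ i, (C i : Type u) →ₗ[A] C (i+1)),
    (∀ i ≤ m, InAdd A M (C i)) ∧
    (∀ i, m < i → Subsingleton (C i)) ∧
    Function.Injective g ∧ Function.Exact g (f 0) ∧
    (∀ i, Function.Exact (f i) (f (i+1))) ∧
    Function.Surjective (fun φ : (C 0 : Type u) →ₗ[A] M => φ ∘ₗ g) ∧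
    Function.Exact (fun φ : (C 1 : Type u) →ₗ[A] M => φ ∘ₗ (f 0))
      (fun φ : (C 0 : Type u) →ₗ[A] M => φ ∘ₗ g) ∧
    (∀ i, Function.Exact (fun φ : (C (i+2) : Type u) →ₗ[A] M => φ ∘ₗ (f (i+1)))
      (fun φ : (C (i+1) : Type u) →ₗ[A] M => φ ∘ₗ (f i)))

/-- The canonical ring homomorphism from `Λ` to the endomorphism ring of `I` over
`End_Λ(I)`, sending `λ` to multiplication by `λ`. -/
@[simps] def evalRingHom (Λ : Type u) [Ring Λ] (I : Type u) [AddCommGroup I] [Module Λ I] :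
    Λ →+* Module.End (Module.End Λ I) I where
  toFun a :=
    { toFun := fun x => a • x
      map_add' := fun x y => smul_add a x y
      map_smul' := fun φ x => (φ.map_smul a x).symm }
  map_one' := by ext x; simp
  map_mul' a b := by ext x; simp [mul_smul]
  map_zero' := by ext x; simp
  map_add' a b := by ext x; simp [add_smul]

section InjectiveModules

variable {Γ : Type u} [Ring Γ]

/-- A map into an injective module factors through any map with smaller kernel. -/
theorem Module.Injective.exists_comp_eq_of_ker_le {V W T : Type u} [AddCommGroup V] [Module Γ V]
    [AddCommGroup W] [Module Γ W] [AddCommGroup T] [Module Γ T] (hT : Module.Injective Γ T)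
    (p : V →ₗ[Γ] W) (x : V →ₗ[Γ] T) (h : LinearMap.ker p ≤ LinearMap.ker x) :
    ∃ y : W →ₗ[Γ] T, y ∘ₗ p = x := by
  obtain ⟨y, hy⟩ := hT.out ((LinearMap.ker p).liftQ p le_rfl)
    (LinearMap.ker_eq_bot.1 (Submodule.ker_liftQ_eq_bot' _ _ rfl)) ((LinearMap.ker p).liftQ x h)
  exact ⟨y, LinearMap.ext fun v => by simpa using hy ((LinearMap.ker p).mkQ v)⟩

theorem Module.Injective.of_bijective_comp {E J : Type u} [AddCommGroup E] [Module Γ E]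
    [AddCommGroup J] [Module Γ J] (hJ : Module.Injective Γ J) (s : E →ₗ[Γ] J) (r : J →ₗ[Γ] E)
    (h : Function.Bijective (r ∘ₗ s)) : Module.Injective Γ E where
  out X Y _ _ _ _ f hf g := by
    obtain ⟨k, hk⟩ := hJ.out f hf (s ∘ₗ g)
    refine ⟨(LinearEquiv.ofBijective _ h).symm.toLinearMap ∘ₗ r ∘ₗ k, fun x => ?_⟩
    simp only [LinearMap.comp_apply, LinearEquiv.coe_coe, LinearEquiv.symm_apply_eq, hk]
    rfl

theorem Module.Projective.of_bijective_comp {E P : Type*} [AddCommGroup E] [Module Γ E]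
    [AddCommGroup P] [Module Γ P] [Module.Projective Γ P] (s : E →ₗ[Γ] P) (r : P →ₗ[Γ] E)
    (h : Function.Bijective (r ∘ₗ s)) : Module.Projective Γ E := by
  refine Module.Projective.of_split s ((LinearEquiv.ofBijective _ h).symm.toLinearMap ∘ₗ r) ?_
  ext x
  simp only [LinearMap.comp_apply, LinearEquiv.coe_coe, LinearEquiv.symm_apply_eq]
  rfl

/-- A map from a finitely generated module to a projective module has the same kernel as some map
to a finite free module factoring through it. -/
theorem Module.Projective.exists_finite_free_ker_le {W P : Type u} [AddCommGroup W] [Module Γ W]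
    [Module.Finite Γ W] [AddCommGroup P] [Module Γ P] (hP : Module.Projective Γ P)
    (a : W →ₗ[Γ] P) :
    ∃ (S : Finset P) (c : P →ₗ[Γ] (S → Γ)), ∀ w, c (a w) = 0 → a w = 0 := by
  classical
  obtain ⟨s, hs⟩ := Module.projective_def'.1 hP
  obtain ⟨G, hG⟩ := Module.Finite.fg_top (R := Γ) (M := W)
  refine ⟨G.biUnion fun w => (s (a w)).support,
    LinearMap.pi fun j => Finsupp.lapply (j : P) ∘ₗ s, fun w hw => ?_⟩
  have key : (⊤ : Submodule Γ W) ≤ (Finsupp.supported Γ Γ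
      (↑(G.biUnion fun w => (s (a w)).support) : Set P)).comap (s ∘ₗ a) := by
    rw [← hG, Submodule.span_le]
    intro v hv
    simp only [SetLike.mem_coe, Submodule.mem_comap, LinearMap.comp_apply,
      Finsupp.mem_supported, Finset.coe_subset]
    exact Finset.subset_biUnion_of_mem (fun w => (s (a w)).support) hv
  have hsupp := (Finsupp.mem_supported' Γ (s (a w))).1 (key (Submodule.mem_top (x := w)))
  have hzero : s (a w) = 0 := by
    ext j
    by_cases hj : j ∈ (↑(G.biUnion fun w => (s (a w)).support) : Set P)
    · exact congrFun hw ⟨j, hj⟩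
    · exact hsupp j hj
  simpa [hzero] using (LinearMap.congr_fun hs (a w)).symm

/-- If a finitely generated module over a left Artinian ring embeds into a projective-injective
module, then it embeds into a finitely generated one. -/
theorem exists_finite_projective_injective_embedding [IsArtinianRing Γ] {W J : Type u}
    [AddCommGroup W] [Module Γ W] [Module.Finite Γ W] [AddCommGroup J] [Module Γ J]
    (hP : Module.Projective Γ J) (hJ : Module.Injective Γ J) (g : W →ₗ[Γ] J)
    (hg : Function.Injective g) :
    ∃ (E : Type u) (_ : AddCommGroup E) (_ : Module Γ E) (i : W →ₗ[Γ] E),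
      Module.Finite Γ E ∧ Module.Projective Γ E ∧ Module.Injective Γ E ∧
      Function.Injective i := by
  obtain ⟨S, q, hq⟩ := hP.exists_finite_free_ker_le g
  have hqg : Function.Injective (q ∘ₗ g) := by
    rw [injective_iff_map_eq_zero]
    exact fun w hw => (injective_iff_map_eq_zero g).1 hg w (hq w hw)
  obtain ⟨h, hh⟩ := hJ.out (q ∘ₗ g) hqg g
  let e : Module.End Γ (S → Γ) := q ∘ₗ h
  have he : ∀ n : ℕ, ∀ w, (e ^ n) (q (g w)) = q (g w) := by
    intro n w
    induction n with
    | zero => simp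
    | succ n ih =>
      rw [pow_succ, Module.End.mul_apply]
      have : e (q (g w)) = q (g w) := congrArg q (hh w)
      rw [this, ih]
  obtain ⟨n, hn, hn1⟩ := ((LinearMap.eventually_isCompl_ker_pow_range_pow e).and
    (Filter.eventually_ge_atTop 1)).exists
  let u : (S → Γ) →ₗ[Γ] LinearMap.range (e ^ n) := (e ^ n).rangeRestrict
  let E := LinearMap.range (e ^ n)
  have hbij : Function.Bijective ((u ∘ₗ e) ∘ₗ E.subtype) := by
    refine IsArtinian.bijective_of_injective_endomorphism _ ?_
    rw [injective_iff_map_eq_zero]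
    rintro ⟨x, hx⟩ hx0
    have h1 : (e ^ (n + 1)) x = 0 := by
      rw [pow_succ, Module.End.mul_apply]
      exact congrArg Subtype.val hx0
    have h2 : (e ^ n) ((e ^ n) x) = 0 := by
      rw [← Module.End.mul_apply, ← pow_add, show n + n = (n - 1) + (n + 1) by omega, pow_add,
        Module.End.mul_apply, h1, map_zero]
    have h3 : (e ^ n) x = 0 := (Submodule.disjoint_def.1 hn.disjoint) _ h2 ⟨x, rfl⟩
    exact Subtype.ext ((Submodule.disjoint_def.1 hn.disjoint) _ h3 hx)
  refine ⟨E, inferInstance, inferInstance, u ∘ₗ q ∘ₗ g, inferInstance,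
    Module.Projective.of_bijective_comp E.subtype (u ∘ₗ e) hbij,
    hJ.of_bijective_comp (h ∘ₗ E.subtype) (u ∘ₗ q) hbij, ?_⟩
  intro v w hvw
  apply hqg
  have := congrArg Subtype.val hvw
  change (e ^ n) (q (g v)) = (e ^ n) (q (g w)) at this
  rwa [he, he] at this

end InjectiveModules

section EndomorphismRing

variable {Γ : Type u} [Ring Γ] {T : Type u} [AddCommGroup T] [Module Γ T]

/-- A finitely generated projective module is a generator over its endomorphism ring. -/
theorem inAdd_end_of_projective [Module.Finite Γ T] (hT : Module.Projective Γ T) :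
    InAdd (Module.End Γ T) T (Module.End Γ T) := by
  obtain ⟨n, p, s, -, -, hps⟩ := Module.Finite.exists_comp_eq_id_of_projective Γ T
  refine ⟨n,
    { toFun := fun a j => a (p (Pi.single j 1))
      map_add' := fun a b => rfl
      map_smul' := fun a b => rfl },
    { toFun := fun t => ∑ j, (LinearMap.toSpanSingleton Γ T (t j)) ∘ₗ LinearMap.proj j ∘ₗ s
      map_add' := fun t t' => by
        ext x
        simp [Finset.sum_add_distrib]
      map_smul' := fun a t => by
        ext x
        simp }, ?_⟩
  refine LinearMap.ext fun a => LinearMap.ext fun x => ?_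
  have hx : p (s x) = x := LinearMap.congr_fun hps x
  have : s x = ∑ j, s x j • Pi.single j (1 : Γ) := by
    ext j
    simp [Pi.single_apply]
  conv_rhs => rw [LinearMap.id_apply, ← hx, this]
  simp

/-- Maps into an injective module `T` that vanish on the common kernel of finitely many maps are
combinations of these with coefficients in the endomorphism ring of `T`. -/
theorem Module.Injective.mem_of_inf_ker_le (hT : Module.Injective Γ T) {V : Type u}
    [AddCommGroup V] [Module Γ V] (N : Submodule (Module.End Γ T) (V →ₗ[Γ] T))
    (t : Finset N) (x : V →ₗ[Γ] T)
    (hx : (t.inf fun ν => LinearMap.ker (ν : V →ₗ[Γ] T)) ≤ LinearMap.ker x) : x ∈ N := by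
  classical
  obtain ⟨y, hy⟩ := hT.exists_comp_eq_of_ker_le
    (LinearMap.pi fun ν : t => ((ν : N) : V →ₗ[Γ] T)) x (by
      refine le_trans (fun v hv => ?_) hx
      rw [Submodule.mem_finsetInf]
      exact fun ν hν => congrFun hv ⟨ν, hν⟩)
  have : x = ∑ ν : t, (y ∘ₗ LinearMap.single Γ (fun _ : t => T) ν : Module.End Γ T) •
      ((ν : N) : V →ₗ[Γ] T) := by
    ext v
    rw [← hy, LinearMap.comp_apply, ← Finset.univ_sum_single (LinearMap.pi _ v), map_sum]
    simp
  rw [this]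
  exact Submodule.sum_mem _ fun ν _ => N.smul_mem _ (ν : N).2

/-- A finitely generated injective module over a left Artinian ring is a cogenerator over its
endomorphism ring. -/
theorem isCogenerator_end_of_injective [IsArtinianRing Γ] [Module.Finite Γ T]
    (hT : Module.Injective Γ T) : IsCogenerator (Module.End Γ T) T := by
  intro X _ _ hX
  obtain ⟨n, π, hπ⟩ := Module.Finite.exists_fin' (Module.End Γ T) X
  let c : ((Fin n → T) →ₗ[Γ] T) →ₗ[Module.End Γ T] X := π ∘ₗ
    { toFun := fun φ j => φ ∘ₗ LinearMap.single Γ (fun _ => T) j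
      map_add' := fun _ _ => rfl
      map_smul' := fun _ _ => rfl }
  have hc : Function.Surjective c := by
    intro x
    obtain ⟨a, rfl⟩ := hπ x
    refine ⟨∑ j, a j ∘ₗ LinearMap.proj j, congrArg π ?_⟩
    ext j v
    simp [Pi.single_apply, apply_ite]
  obtain ⟨t, ht⟩ := Finset.exists_inf_le
    (fun ν : LinearMap.ker c => LinearMap.ker (ν : (Fin n → T) →ₗ[Γ] T))
  obtain ⟨k, v, hv⟩ := Submodule.fg_iff_exists_fin_generating_family.1
    (IsNoetherian.noetherian (t.inf fun ν => LinearMap.ker (ν : (Fin n → T) →ₗ[Γ] T)))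
  let d : ((Fin n → T) →ₗ[Γ] T) →ₗ[Module.End Γ T] (Fin k → T) :=
    { toFun := fun φ j => φ (v j)
      map_add' := fun _ _ => rfl
      map_smul' := fun _ _ => rfl }
  have hd : LinearMap.ker d = LinearMap.ker c := by
    apply le_antisymm
    · intro φ hφ
      refine hT.mem_of_inf_ker_le (LinearMap.ker c) t φ ?_
      rw [← hv, Submodule.span_le]
      rintro _ ⟨j, rfl⟩
      exact congrFun hφ j
    · intro φ hφ
      ext j
      exact ht ⟨φ, hφ⟩ (hv ▸ Submodule.subset_span ⟨j, rfl⟩)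
  have hinj : Function.Injective ((LinearMap.ker c).liftQ d hd.ge) :=
    LinearMap.ker_eq_bot.1 (Submodule.ker_liftQ_eq_bot _ _ _ hd.le)
  exact ⟨k, (LinearMap.ker c).liftQ d hd.ge ∘ₗ
    (c.quotKerEquivOfSurjective hc).symm.toLinearMap, hinj.comp (LinearEquiv.injective _)⟩

/-- Double centralizer property: if the regular module embeds into a finite power of an injective
module `T` as the common kernel of maps to `T`, then the canonical map to the double
endomorphism ring is bijective. -/
theorem evalRingHom_bijective_of_embedding (hT : Module.Injective Γ T) {k : ℕ}
    (i : Γ →ₗ[Γ] (Fin k → T)) (hi : Function.Injective i)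
    (hrange : ∀ y, (∀ δ : (Fin k → T) →ₗ[Γ] T, δ ∘ₗ i = 0 → δ y = 0) → ∃ γ, i γ = y) :
    Function.Bijective (evalRingHom Γ T) := by
  have hi1 : ∀ γ, i γ = γ • i 1 := fun γ => by rw [← map_smul, smul_eq_mul, mul_one]
  have hsum : ∀ (δ : (Fin k → T) →ₗ[Γ] T) (y : Fin k → T),
      δ y = ∑ j, (δ ∘ₗ LinearMap.single Γ (fun _ => T) j : Module.End Γ T) • y j := by
    intro δ y
    conv_lhs => rw [← Finset.univ_sum_single y, map_sum]
    rfl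
  constructor
  · rw [injective_iff_map_eq_zero]
    intro γ hγ
    apply (injective_iff_map_eq_zero i).1 hi
    ext j
    rw [hi1]
    exact LinearMap.congr_fun hγ (i 1 j)
  · intro φ
    have hφ : ∀ (δ : (Fin k → T) →ₗ[Γ] T) (y : Fin k → T), δ (fun j => φ (y j)) = φ (δ y) := by
      intro δ y
      rw [hsum, hsum δ y, map_sum]
      simp only [map_smul]
    obtain ⟨γ, hγ⟩ := hrange (fun j => φ (i 1 j)) fun δ hδ => by
      rw [hφ, ← LinearMap.comp_apply, hδ, LinearMap.zero_apply, map_zero]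
    refine ⟨γ, LinearMap.ext fun t => ?_⟩
    obtain ⟨δ, hδ⟩ := hT.out i hi (LinearMap.toSpanSingleton Γ T t)
    have ht : δ (i 1) = t := by simpa using hδ 1
    calc evalRingHom Γ T γ t = γ • δ (i 1) := by rw [ht]; rfl
      _ = δ (i γ) := by rw [hi1 γ, map_smul]
      _ = φ t := by rw [hγ, hφ, ht]

end EndomorphismRing

/-- Let `Γ` be an Artin algebra with dominant dimension at least `2` and let
`T` be a maximal projective-injective `Γ`-module. Then `T`, viewed as a module over
`A = End_Γ(T)`, is a generator-cogenerator and the canonical ring homomorphism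
`Γ → End_A(T)` is an isomorphism. -/
theorem stmt9 (R : Type u) [CommRing R] [IsArtinianRing R]
    (Γ : Type u) [Ring Γ] [Algebra R Γ] [Module.Finite R Γ]
    (hdd : ∃ (J₀ J₁ : ModuleCat.{u} Γ) (g : Γ →ₗ[Γ] J₀) (f : (J₀ : Type u) →ₗ[Γ] J₁),
      Module.Projective Γ J₀ ∧ Module.Injective Γ J₀ ∧
      Module.Projective Γ J₁ ∧ Module.Injective Γ J₁ ∧
      Function.Injective g ∧ Function.Exact g f)
    (T : Type u) [AddCommGroup T] [Module Γ T] [Module.Finite Γ T]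
    (hTproj : Module.Projective Γ T) (hTinj : Module.Injective Γ T)
    (hTmax : ∀ (X : Type u) [AddCommGroup X] [Module Γ X], Module.Finite Γ X →
      Module.Projective Γ X → Module.Injective Γ X → InAdd Γ T X) :
    InAdd (Module.End Γ T) T (Module.End Γ T) ∧ IsCogenerator (Module.End Γ T) T ∧
    Function.Bijective (evalRingHom Γ T) := by
  have : IsArtinianRing Γ := IsArtinianRing.of_finite R Γ
  refine ⟨inAdd_end_of_projective hTproj, isCogenerator_end_of_injective hTinj, ?_⟩
  obtain ⟨J₀, J₁, g, f, hP₀, hI₀, hP₁, -, hg, hgf⟩ := hdd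
  obtain ⟨E, _, _, i₀, hEfin, hEproj, hEinj, hi₀⟩ :=
    exists_finite_projective_injective_embedding hP₀ hI₀ g hg
  obtain ⟨k, ι, π, hπι⟩ := hTmax E hEfin hEproj hEinj
  have hι : Function.Injective ι :=
    Function.LeftInverse.injective (g := π) fun x => LinearMap.congr_fun hπι x
  let i : Γ →ₗ[Γ] (Fin k → T) := ι ∘ₗ i₀
  have hi : Function.Injective i := hι.comp hi₀
  refine evalRingHom_bijective_of_embedding hTinj i hi fun y hy => ?_
  obtain ⟨a, ha⟩ := hI₀.out i hi g
  obtain ⟨b, hb⟩ := hEinj.out g hg i₀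
  obtain ⟨S, c, hc⟩ := hP₁.exists_finite_free_ker_le (f ∘ₗ a)
  have hfay : f (a y) = 0 := by
    refine hc y (funext fun s => hi (funext fun l => ?_))
    have := hy (LinearMap.proj l ∘ₗ i ∘ₗ LinearMap.proj s ∘ₗ c ∘ₗ f ∘ₗ a) (by
      ext
      simp [ha, hgf.apply_apply_eq_zero])
    simpa using this
  obtain ⟨γ, hγ⟩ := (hgf _).1 hfay
  refine ⟨γ, funext fun l => ?_⟩
  have := hy (LinearMap.proj l ∘ₗ (LinearMap.id - ι ∘ₗ b ∘ₗ a)) (by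
    ext
    simp only [LinearMap.comp_apply, LinearMap.sub_apply, ha, hb]
    simp [i])
  have hyl : y l = ι (b (a y)) l := by simpa [sub_eq_zero] using this
  rw [hyl, ← hγ, hb]
  rfl
end

section
/- Let A be an Artin algebra and M a finitely generated A-module satisfying (i) M is a cogenerator over A, (ii) Ext^i_A(M,M) = 0 for 1 ≤ i ≤ n−1 for some n ≥ 1, and (iii) there is an exact sequence 0 → A → M_0 → ⋯ → M_m → 0 with each M_i ∈ add M which remains exact under Hom_A(−,M) and such that the projective dimension of M_0 ⊕ ⋯ ⊕ M_m over A is at most m, where m < n. Let Λ = End_A(M). Then there exists a finitely generated injective right Λ-module J with projective dimension at most m and an exact sequence 0 → Λ → J_0 → J_1 → ⋯ → J_n of right Λ-modules with each J_i ∈ add J (i.e., J-domdim Λ_Λ ≥ n+1). -/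
open CategoryTheory

universe u

section Ext

variable {A : Type u} [Ring A] {K X Z Y W : Type u}
  [AddCommGroup K] [Module A K] [AddCommGroup X] [Module A X] [AddCommGroup Z] [Module A Z]
  [AddCommGroup Y] [Module A Y] [AddCommGroup W] [Module A W]

/-- The short complex of module categories attached to a short exact sequence of modules. -/
noncomputable abbrev linearShortComplex {i : K →ₗ[A] X} {p : X →ₗ[A] Z}
    (h : Function.Exact i p) : ShortComplex (ModuleCat.{u} A) :=
  ShortComplex.mk (ModuleCat.ofHom i) (ModuleCat.ofHom p) (by
    ext x; exact h.apply_apply_eq_zero x)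

lemma linearShortComplex_shortExact {i : K →ₗ[A] X} {p : X →ₗ[A] Z}
    (hi : Function.Injective i) (h : Function.Exact i p) (hp : Function.Surjective p) :
    (linearShortComplex h).ShortExact :=
  ModuleCat.shortComplex_shortExact _ h hi hp

lemma ExtVanishes.of_contravariant_right {i : K →ₗ[A] X} {p : X →ₗ[A] Z}
    (hi : Function.Injective i) (h : Function.Exact i p) (hp : Function.Surjective p) {j : ℕ}
    (hK : ExtVanishes A K Y j) (hX : ExtVanishes A X Y (j + 1)) : ExtVanishes A Z Y (j + 1) := by
  have hS := linearShortComplex_shortExact hi h hp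
  refine subsingleton_of_forall_eq 0 fun x => ?_
  obtain ⟨y, rfl⟩ := Abelian.Ext.contravariant_sequence_exact₃ hS (ModuleCat.of A Y) x
    (hX.elim _ _) (Nat.add_comm 1 j)
  rw [hK.elim y 0, Abelian.Ext.comp_zero]

lemma ExtVanishes.of_contravariant_left {i : K →ₗ[A] X} {p : X →ₗ[A] Z}
    (hi : Function.Injective i) (h : Function.Exact i p) (hp : Function.Surjective p) {j : ℕ}
    (hX : ExtVanishes A X Y j) (hZ : ExtVanishes A Z Y (j + 1)) : ExtVanishes A K Y j := by
  have hS := linearShortComplex_shortExact hi h hp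
  refine subsingleton_of_forall_eq 0 fun x => ?_
  obtain ⟨y, rfl⟩ := Abelian.Ext.contravariant_sequence_exact₁ hS (ModuleCat.of A Y) x
    (Nat.add_comm 1 j) (hZ.elim _ _)
  rw [hX.elim y 0, Abelian.Ext.comp_zero]

lemma ExtVanishes.of_covariant_right {i : K →ₗ[A] X} {p : X →ₗ[A] Z}
    (hi : Function.Injective i) (h : Function.Exact i p) (hp : Function.Surjective p) {j : ℕ}
    (hX : ExtVanishes A W X j) (hK : ExtVanishes A W K (j + 1)) : ExtVanishes A W Z j := by
  have hS := linearShortComplex_shortExact hi h hp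
  refine subsingleton_of_forall_eq 0 fun x => ?_
  obtain ⟨y, rfl⟩ := Abelian.Ext.covariant_sequence_exact₃ (ModuleCat.of A W) hS x
    rfl (hK.elim _ _)
  rw [hX.elim y 0, Abelian.Ext.zero_comp]

lemma ExtVanishes.exists_extend {i : K →ₗ[A] X} {p : X →ₗ[A] Z}
    (hi : Function.Injective i) (h : Function.Exact i p) (hp : Function.Surjective p)
    (hZ : ExtVanishes A Z Y 1) (φ : K →ₗ[A] Y) : ∃ ψ : X →ₗ[A] Y, ψ ∘ₗ i = φ := by
  have hS := linearShortComplex_shortExact hi h hp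
  obtain ⟨y, hy⟩ := Abelian.Ext.contravariant_sequence_exact₁ hS (ModuleCat.of A Y)
    (Abelian.Ext.mk₀ (ModuleCat.ofHom φ)) (n₁ := 1) rfl (hZ.elim _ _)
  obtain ⟨y, rfl⟩ := Abelian.Ext.addEquiv₀.symm.surjective y
  refine ⟨y.hom, ?_⟩
  have h2 := (Abelian.Ext.mk₀_comp_mk₀ _ _).symm.trans hy
  have h3 := Abelian.Ext.addEquiv₀.symm.injective h2
  exact congrArg ModuleCat.Hom.hom h3

lemma ExtVanishes.exists_lift {i : K →ₗ[A] X} {p : X →ₗ[A] Z}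
    (hi : Function.Injective i) (h : Function.Exact i p) (hp : Function.Surjective p)
    (hW : ExtVanishes A W K 1) (φ : W →ₗ[A] Z) : ∃ ψ : W →ₗ[A] X, p ∘ₗ ψ = φ := by
  have hS := linearShortComplex_shortExact hi h hp
  obtain ⟨y, hy⟩ := Abelian.Ext.covariant_sequence_exact₃ (ModuleCat.of A W) hS
    (Abelian.Ext.mk₀ (ModuleCat.ofHom φ)) (n₁ := 1) rfl (hW.elim _ _)
  obtain ⟨y, rfl⟩ := Abelian.Ext.addEquiv₀.symm.surjective y
  refine ⟨y.hom, ?_⟩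
  have h2 := (Abelian.Ext.mk₀_comp_mk₀ _ _).symm.trans hy
  have h3 := Abelian.Ext.addEquiv₀.symm.injective h2
  exact congrArg ModuleCat.Hom.hom h3

lemma ExtVanishes.of_projective [Module.Projective A X] (j : ℕ) : ExtVanishes A X Y (j + 1) := by
  have : Projective (ModuleCat.of A X) := (IsProjective.iff_projective X).mp inferInstance
  exact subsingleton_of_forall_eq 0 fun x => Abelian.Ext.eq_zero_of_projective x

lemma ExtVanishes.of_injective [Module.Injective A Y] (j : ℕ) : ExtVanishes A X Y (j + 1) := by
  have : Injective (ModuleCat.of A Y) :=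
    (Module.injective_iff_injective_object A Y).mp inferInstance
  exact subsingleton_of_forall_eq 0 fun x => Abelian.Ext.eq_zero_of_injective x

lemma ExtVanishes.of_sum_eq_id {ι : Type} [Fintype ι] {V : ι → Type u}
    [∀ i, AddCommGroup (V i)] [∀ i, Module A (V i)]
    (a : ∀ i, X →ₗ[A] V i) (b : ∀ i, V i →ₗ[A] X) (hab : ∑ i, b i ∘ₗ a i = LinearMap.id) {j : ℕ}
    (h : ∀ i, ExtVanishes A (V i) Y j) : ExtVanishes A X Y j := by
  refine subsingleton_of_forall_eq 0 fun x => ?_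
  have h1 : (𝟙 (ModuleCat.of A X)) = ∑ i, ModuleCat.ofHom (a i) ≫ ModuleCat.ofHom (b i) := by
    ext x
    rw [ModuleCat.hom_sum]
    exact (LinearMap.congr_fun hab x).symm
  rw [← Abelian.Ext.mk₀_id_comp x, h1, Abelian.Ext.mk₀_sum, Abelian.Ext.sum_comp]
  refine Finset.sum_eq_zero fun i _ => ?_
  rw [← Abelian.Ext.mk₀_comp_mk₀_assoc, (h i).elim ((Abelian.Ext.mk₀ _).comp x _) 0,
    Abelian.Ext.comp_zero]

lemma Module.Projective.of_extVanishes_one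
    (h : ∀ (Y : Type u) [AddCommGroup Y] [Module A Y], ExtVanishes A X Y 1) :
    Module.Projective A X := by
  let p : (X →₀ A) →ₗ[A] X := Finsupp.linearCombination A id
  have hp : Function.Surjective p := Finsupp.linearCombination_id_surjective A X
  obtain ⟨s, hs⟩ := ExtVanishes.exists_lift (i := (LinearMap.ker p).subtype)
    (LinearMap.ker p).injective_subtype (LinearMap.exact_subtype_ker_map p) hp
    (h (LinearMap.ker p)) LinearMap.id
  exact Module.Projective.of_split s p hs

end Ext

section ProjDim

variable {A : Type u} [Ring A] {K X N Y : Type u}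
  [AddCommGroup K] [Module A K] [AddCommGroup X] [Module A X] [AddCommGroup N] [Module A N]
  [AddCommGroup Y] [Module A Y]

lemma ProjDimLE.extVanishes {d : ℕ} (h : ProjDimLE A N d) {j : ℕ} (hj : d ≤ j) :
    ExtVanishes A N Y (j + 1) := by
  induction d generalizing N j with
  | zero =>
    obtain ⟨P, f, g, hP, h0, hg, hfg, -⟩ := h
    have := h0 1 one_pos
    have hinj : Function.Injective g := by
      rw [injective_iff_map_eq_zero]
      intro x hx
      obtain ⟨y, rfl⟩ := (hfg x).mp hx
      rw [Subsingleton.elim y 0, map_zero]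
    have := hP 0
    have := Module.Projective.of_equiv (LinearEquiv.ofBijective g ⟨hinj, hg⟩)
    exact ExtVanishes.of_projective j
  | succ d ih =>
    obtain ⟨P, f, g, hP, h0, hg, hfg, hf⟩ := h
    obtain ⟨j, rfl⟩ := Nat.exists_eq_add_of_le' (Nat.one_le_of_lt hj)
    have hK : ProjDimLE A (LinearMap.ker g) d := by
      refine ⟨fun i => P (i + 1), fun i => f (i + 1),
        (f 0).codRestrict (LinearMap.ker g) fun x => hfg.apply_apply_eq_zero x,
        fun i => hP _, fun i hi => h0 _ (by omega), ?_, ?_, fun i => hf _⟩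
      · rintro ⟨x, hx⟩
        obtain ⟨y, rfl⟩ := (hfg x).mp hx
        exact ⟨y, rfl⟩
      · intro x
        rw [← hf 0 x, Subtype.ext_iff]
        rfl
    have := hP 0
    exact ExtVanishes.of_contravariant_right (LinearMap.ker g).injective_subtype
      (LinearMap.exact_subtype_ker_map g) hg (ih hK (by omega)) (ExtVanishes.of_projective _)

lemma ProjDimLE.of_projective [Module.Projective A N] (d : ℕ) : ProjDimLE A N d := by
  refine ⟨fun i => match i with
    | 0 => ModuleCat.of A N
    | _ + 1 => ModuleCat.of A PUnit.{u + 1}, fun i => 0, LinearMap.id, ?_, ?_, ?_, ?_, ?_⟩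
  · rintro (_ | i)
    · assumption
    · exact inferInstanceAs (Module.Projective A PUnit.{u + 1})
  · rintro (_ | i) hi
    · omega
    · exact inferInstanceAs (Subsingleton PUnit.{u + 1})
  · exact Function.surjective_id
  · exact fun x => ⟨fun hx => ⟨0, hx.symm⟩, fun ⟨y, hy⟩ => hy.symm⟩
  · exact fun i x => ⟨fun _ => ⟨0, Subsingleton.elim (α := PUnit.{u + 1}) _ _⟩, fun _ => rfl⟩

lemma ProjDimLE.of_shortExact {i : K →ₗ[A] X} {p : X →ₗ[A] N} [Module.Projective A X]
    (hi : Function.Injective i) (h : Function.Exact i p) (hp : Function.Surjective p)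
    {d : ℕ} (hK : ProjDimLE A K d) : ProjDimLE A N (d + 1) := by
  obtain ⟨P, f, g, hP, h0, hg, hfg, hf⟩ := hK
  refine ⟨fun j => match j with
    | 0 => ModuleCat.of A X
    | j + 1 => P j, fun j => match j with
    | 0 => i ∘ₗ g
    | j + 1 => f j, p, ?_, ?_, hp, ?_, ?_⟩
  · rintro (_ | j)
    · assumption
    · exact hP j
  · rintro (_ | j) hj
    · omega
    · exact h0 j (by omega)
  · intro x
    rw [h x]
    constructor
    · rintro ⟨y, rfl⟩
      obtain ⟨z, rfl⟩ := hg y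
      exact ⟨z, rfl⟩
    · rintro ⟨z, rfl⟩
      exact ⟨g z, rfl⟩
  · rintro (_ | j)
    · intro x
      rw [← hfg x]
      exact map_eq_zero_iff i hi
    · exact hf j

end ProjDim

section InAdd

variable {Λ : Type u} [Ring Λ] {M X X' Y : Type u} [AddCommGroup M] [Module Λ M]
  [AddCommGroup X] [Module Λ X] [AddCommGroup X'] [Module Λ X'] [AddCommGroup Y] [Module Λ Y]

lemma InAdd.of_sum_eq_id {ι : Type} [Fintype ι] (a : ι → X →ₗ[Λ] M) (b : ι → M →ₗ[Λ] X)
    (h : ∑ i, b i ∘ₗ a i = LinearMap.id) : InAdd Λ M X := by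
  let e := Fintype.equivFin ι
  refine ⟨Fintype.card ι, LinearMap.pi fun j => a (e.symm j),
    ∑ j, b (e.symm j) ∘ₗ LinearMap.proj j, ?_⟩
  rw [← h]
  ext x
  simp only [LinearMap.comp_apply, LinearMap.sum_apply, LinearMap.proj_apply, LinearMap.pi_apply]
  exact e.symm.sum_comp fun i => b i (a i x)

lemma InAdd.exists_sum_eq_id (h : InAdd Λ M X) :
    ∃ (k : ℕ) (a : Fin k → X →ₗ[Λ] M) (b : Fin k → M →ₗ[Λ] X),
      ∑ i, b i ∘ₗ a i = LinearMap.id := by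
  obtain ⟨k, ι, π, hπ⟩ := h
  refine ⟨k, fun i => LinearMap.proj i ∘ₗ ι,
    fun i => π ∘ₗ LinearMap.single Λ (fun _ => M) i, ?_⟩
  rw [← hπ]
  ext x
  simp only [LinearMap.comp_apply, LinearMap.sum_apply, LinearMap.proj_apply, ← map_sum]
  congr 1
  exact LinearMap.sum_single_apply (fun _ => M) (ι x)

lemma InAdd.of_subsingleton [Subsingleton X] : InAdd Λ M X :=
  InAdd.of_sum_eq_id (ι := Empty) (fun _ => 0) (fun _ => 0) (LinearMap.ext fun _ =>
    Subsingleton.elim _ _)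

lemma InAdd.of_retract (a : X →ₗ[Λ] M) (b : M →ₗ[Λ] X) (h : b ∘ₗ a = LinearMap.id) :
    InAdd Λ M X :=
  InAdd.of_sum_eq_id (ι := Unit) (fun _ => a) (fun _ => b) (by simpa using h)

lemma InAdd.prod (h : InAdd Λ M X) (h' : InAdd Λ M X') : InAdd Λ M (X × X') := by
  obtain ⟨k, a, b, hab⟩ := h.exists_sum_eq_id
  obtain ⟨k', a', b', hab'⟩ := h'.exists_sum_eq_id
  refine InAdd.of_sum_eq_id (ι := Fin k ⊕ Fin k')
    (Sum.elim (fun i => a i ∘ₗ LinearMap.fst Λ X X') (fun i => a' i ∘ₗ LinearMap.snd Λ X X'))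
    (Sum.elim (fun i => LinearMap.inl Λ X X' ∘ₗ b i) (fun i => LinearMap.inr Λ X X' ∘ₗ b' i)) ?_
  ext1
  · ext1 x
    have : ∑ i, b i (a i x) = x := by simpa using LinearMap.congr_fun hab x
    simp [LinearMap.sum_apply, Prod.ext_iff, Prod.fst_sum, Prod.snd_sum, this]
  · ext1 x
    have : ∑ i, b' i (a' i x) = x := by simpa using LinearMap.congr_fun hab' x
    simp [LinearMap.sum_apply, Prod.ext_iff, Prod.fst_sum, Prod.snd_sum, this]

lemma InAdd.pi {ι : Type} [Fintype ι] [DecidableEq ι] {V : ι → Type u}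
    [∀ i, AddCommGroup (V i)] [∀ i, Module Λ (V i)]
    (h : ∀ i, InAdd Λ M (V i)) : InAdd Λ M (∀ i, V i) := by
  choose k a b hab using fun i => (h i).exists_sum_eq_id
  refine InAdd.of_sum_eq_id (ι := Σ i, Fin (k i)) (fun x => a x.1 x.2 ∘ₗ LinearMap.proj x.1)
    (fun x => LinearMap.single Λ V x.1 ∘ₗ b x.1 x.2) ?_
  rw [Fintype.sum_sigma]
  refine LinearMap.ext fun x => ?_
  have : ∀ i, ∑ j, b i j (a i j (x i)) = x i := fun i => by
    simpa using LinearMap.congr_fun (hab i) (x i)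
  simp only [LinearMap.sum_apply, LinearMap.comp_apply, LinearMap.proj_apply]
  refine (Finset.sum_congr rfl fun i _ => ?_).trans (LinearMap.sum_single_apply V x)
  refine (map_sum (LinearMap.single Λ V i) (fun d => b i d (a i d (x i))) _).symm.trans ?_
  rw [this, LinearMap.single_apply]

lemma InAdd.injective (h : InAdd Λ M X) [hM : Module.Injective Λ M] : Module.Injective Λ X := by
  obtain ⟨k, ι, π, hπ⟩ := h
  have : Module.Injective Λ (Fin k → M) := inferInstance
  refine ⟨fun U V _ _ _ _ f hf g => ?_⟩
  obtain ⟨h, hh⟩ := this.out f hf (ι ∘ₗ g)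
  exact ⟨π ∘ₗ h, fun x => by simpa [hh] using LinearMap.congr_fun hπ (g x)⟩

lemma InAdd.projective (h : InAdd Λ M X) [Module.Projective Λ M] : Module.Projective Λ X := by
  obtain ⟨k, ι, π, hπ⟩ := h
  have : Module.Projective Λ (Fin k → M) :=
    Module.Projective.of_equiv (DFinsupp.linearEquivFunOnFintype (M := fun _ : Fin k => M))
  exact Module.Projective.of_split ι π hπ

lemma InAdd.finite (h : InAdd Λ M X) [Module.Finite Λ M] : Module.Finite Λ X := by
  obtain ⟨k, ι, π, hπ⟩ := h
  exact Module.Finite.of_surjective π fun x => ⟨ι x, LinearMap.congr_fun hπ x⟩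

end InAdd

/-- A linear map vanishing on the kernel of a surjection factors through it. -/
lemma LinearMap.exists_factor {Λ X Z Q : Type*} [Ring Λ] [AddCommGroup X] [Module Λ X]
    [AddCommGroup Z] [Module Λ Z] [AddCommGroup Q] [Module Λ Q] {p : X →ₗ[Λ] Z}
    (hp : Function.Surjective p) (f : X →ₗ[Λ] Q) (hf : ∀ x, p x = 0 → f x = 0) :
    ∃ f' : Z →ₗ[Λ] Q, ∀ x, f' (p x) = f x := by
  refine ⟨(LinearMap.ker p).liftQ f hf ∘ₗ (p.quotKerEquivOfSurjective hp).symm, fun x => ?_⟩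
  have : (p.quotKerEquivOfSurjective hp).symm (p x) = (LinearMap.ker p).mkQ x := by
    rw [LinearEquiv.symm_apply_eq]
    rfl
  rw [LinearMap.comp_apply, LinearEquiv.coe_coe, this]
  rfl

section AddCoresolution

/-- `Y` has an exact coresolution `0 → Y → J_0 → ⋯ → J_{t-1}` with terms in `add J`, described
recursively through its cosyzygies. -/
def HasAddCoresolution (Λ : Type u) [Ring Λ] (J : Type u) [AddCommGroup J] [Module Λ J] :
    ℕ → ∀ (Y : Type u) [AddCommGroup Y] [Module Λ Y], Prop
  | 0, _, _, _ => True
  | t + 1, Y, _, _ => ∃ (X Z : ModuleCat.{u} Λ) (i : Y →ₗ[Λ] X) (p : (X : Type u) →ₗ[Λ] Z),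
      InAdd Λ J X ∧ Function.Injective i ∧ Function.Exact i p ∧ Function.Surjective p ∧
      HasAddCoresolution Λ J t Z

variable {Λ : Type u} [Ring Λ] {J K Y Z : Type u} [AddCommGroup J] [Module Λ J]
  [AddCommGroup K] [Module Λ K] [AddCommGroup Y] [Module Λ Y] [AddCommGroup Z] [Module Λ Z]

lemma HasAddCoresolution.of_equiv {t : ℕ} (h : HasAddCoresolution Λ J t Y) (e : K ≃ₗ[Λ] Y) :
    HasAddCoresolution Λ J t K := by
  cases t with
  | zero => trivial
  | succ t =>
    obtain ⟨X, Z, i, p, hX, hi, hip, hp, hZ⟩ := h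
    refine ⟨X, Z, i ∘ₗ e, p, hX, hi.comp e.injective, fun x => ?_, hp, hZ⟩
    rw [hip x]
    constructor
    · rintro ⟨y, rfl⟩
      exact ⟨e.symm y, by simp⟩
    · rintro ⟨y, rfl⟩
      exact ⟨e y, rfl⟩

lemma HasAddCoresolution.of_injective {t : ℕ} (h : HasAddCoresolution Λ J (t + 1) Y)
    {i : K →ₗ[Λ] Y} (hi : Function.Injective i) : HasAddCoresolution Λ J 1 K := by
  obtain ⟨X, Z, j, p, hX, hj, -⟩ := h
  refine ⟨X, ModuleCat.of Λ (X ⧸ LinearMap.range (j ∘ₗ i)), j ∘ₗ i,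
    (LinearMap.range (j ∘ₗ i)).mkQ, hX, hj.comp hi, ?_, Submodule.mkQ_surjective _, trivial⟩
  exact LinearMap.exact_map_mkQ_range _

lemma HasAddCoresolution.idomdimGE {t : ℕ} (h : HasAddCoresolution Λ J t Y) :
    IDomdimGE Λ J Y t := by
  induction t generalizing Y with
  | zero =>
    exact ⟨fun _ => ModuleCat.of Λ PUnit.{u + 1}, 0, fun _ => 0, fun i hi => by omega,
      fun hi => by omega, fun hi => by omega, fun i hi => by omega⟩
  | succ t ih =>
    obtain ⟨X, Z, i, p, hX, hi, hip, hp, hZ⟩ := h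
    obtain ⟨I, g, f, hI, hg, hgf, hf⟩ := ih hZ
    refine ⟨fun j => match j with
      | 0 => X
      | j + 1 => I j, i, fun j => match j with
      | 0 => g ∘ₗ p
      | j + 1 => f j, ?_, fun _ => hi, ?_, ?_⟩
    · rintro (_ | j) hj
      · exact hX
      · exact hI j (by omega)
    · intro ht x
      rw [← hip x]
      exact map_eq_zero_iff g (hg (by omega))
    · rintro (_ | j) hj
      · intro x
        rw [hgf (by omega) x]
        constructor
        · rintro ⟨y, rfl⟩
          obtain ⟨z, rfl⟩ := hp y
          exact ⟨z, rfl⟩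
        · rintro ⟨z, rfl⟩
          exact ⟨p z, rfl⟩
      · exact hf j (by omega)

lemma HasAddCoresolution.of_exact (C : ℕ → ModuleCat.{u} Λ) (g : Y →ₗ[Λ] C 0)
    (f : ∀ i, (C i : Type u) →ₗ[Λ] C (i + 1)) (hC : ∀ i, InAdd Λ J (C i))
    (hg : Function.Injective g) (hgf : Function.Exact g (f 0))
    (hf : ∀ i, Function.Exact (f i) (f (i + 1))) (t : ℕ) : HasAddCoresolution Λ J t Y := by
  induction t generalizing Y C with
  | zero => trivial
  | succ t ih =>
    refine ⟨C 0, ModuleCat.of Λ (LinearMap.range (f 0)), g, (f 0).rangeRestrict, hC 0, hg, ?_,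
      (f 0).surjective_rangeRestrict, ?_⟩
    · intro x
      rw [← hgf x, Subtype.ext_iff]
      rfl
    · refine ih (fun i => C (i + 1)) (LinearMap.range (f 0)).subtype (fun i => f (i + 1))
        (fun i => hC _) (Submodule.injective_subtype _) ?_ (fun i => hf _)
      intro x
      rw [hf 0 x]
      simp

lemma HasAddCoresolution.pi {t : ℕ} (h : HasAddCoresolution Λ J t Y) (k : ℕ) :
    HasAddCoresolution Λ J t (Fin k → Y) := by
  induction t generalizing Y with
  | zero => trivial
  | succ t ih =>
    obtain ⟨X, Z, i, p, hX, hi, hip, hp, hZ⟩ := h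
    refine ⟨ModuleCat.of Λ (Fin k → X), ModuleCat.of Λ (Fin k → Z), i.compLeft (Fin k),
      p.compLeft (Fin k), InAdd.pi fun _ => hX, hi.comp_left, fun x => ?_, hp.comp_left, ih hZ⟩
    constructor
    · intro hx
      choose y hy using fun j => (hip (x j)).mp (congrFun hx j)
      exact ⟨y, funext hy⟩
    · rintro ⟨y, rfl⟩
      exact funext fun j => hip.apply_apply_eq_zero (y j)

lemma HasAddCoresolution.middle [Module.Injective Λ J] {t : ℕ} {i : K →ₗ[Λ] Y} {q : Y →ₗ[Λ] Z}
    (hi : Function.Injective i) (hiq : Function.Exact i q) (hq : Function.Surjective q)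
    (hK : HasAddCoresolution Λ J t K) (hZ : HasAddCoresolution Λ J t Z) :
    HasAddCoresolution Λ J t Y := by
  induction t generalizing K Y Z with
  | zero => trivial
  | succ t ih =>
    obtain ⟨X, W, a, p, hX, ha, hap, hp, hW⟩ := hK
    obtain ⟨X', W', a', p', hX', ha', hap', hp', hW'⟩ := hZ
    have := hX.injective
    obtain ⟨h, hh⟩ := Module.Injective.out i hi a
    let b : Y →ₗ[Λ] X × X' := h.prod (a' ∘ₗ q)
    let π := (LinearMap.range b).mkQ
    have hπ : Function.Surjective π := Submodule.mkQ_surjective _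
    have hbπ : Function.Exact b π := LinearMap.exact_map_mkQ_range b
    have hb : Function.Injective b := by
      rw [injective_iff_map_eq_zero]
      intro y hy
      have h1 : h y = 0 := congrArg Prod.fst hy
      have h2 : a' (q y) = 0 := congrArg Prod.snd hy
      obtain ⟨z, rfl⟩ := (hiq y).mp ((map_eq_zero_iff a' ha').mp h2)
      rw [hh, map_eq_zero_iff a ha] at h1
      rw [h1, map_zero]
    obtain ⟨r, hr⟩ := LinearMap.exists_factor hp (π ∘ₗ LinearMap.inl Λ X X') fun x hx => by
      obtain ⟨z, rfl⟩ := (hap x).mp hx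
      refine (hbπ _).mpr ⟨i z, Prod.ext (hh z) ?_⟩
      change a' (q (i z)) = 0
      rw [hiq.apply_apply_eq_zero, map_zero]
    obtain ⟨s, hs⟩ := LinearMap.exists_factor hπ (p' ∘ₗ LinearMap.snd Λ X X') fun x hx => by
      obtain ⟨y, rfl⟩ := (hbπ x).mp hx
      exact hap'.apply_apply_eq_zero (q y)
    refine ⟨ModuleCat.of Λ (X × X'), ModuleCat.of Λ ((X × X') ⧸ LinearMap.range b), b, π,
      hX.prod hX', hb, hbπ, hπ, ih (i := r) (q := s) ?_ ?_ ?_ hW hW'⟩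
    · rw [injective_iff_map_eq_zero]
      intro w hw
      obtain ⟨x, rfl⟩ := hp w
      rw [hr] at hw
      obtain ⟨y, hy⟩ := (hbπ _).mp hw
      have h1 : h y = x := congrArg Prod.fst hy
      have h2 : a' (q y) = 0 := congrArg Prod.snd hy
      obtain ⟨z, rfl⟩ := (hiq y).mp ((map_eq_zero_iff a' ha').mp h2)
      rw [← h1, hh, hap.apply_apply_eq_zero]
    · intro w
      obtain ⟨⟨x, x'⟩, rfl⟩ := hπ w
      rw [hs]
      constructor
      · intro hx
        obtain ⟨z, hz⟩ := (hap' x').mp hx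
        obtain ⟨y, rfl⟩ := hq z
        refine ⟨p (x - h y), ?_⟩
        rw [hr, LinearMap.comp_apply, ← sub_eq_zero, ← map_sub]
        refine (hbπ _).mpr ⟨-y, Prod.ext ?_ ?_⟩
        · simp [b]
        · simp [b, hz]
      · rintro ⟨z, hz⟩
        obtain ⟨x'', rfl⟩ := hp z
        rw [← hs, ← hz, hr, LinearMap.comp_apply, hs]
        simp
    · intro w'
      obtain ⟨x', rfl⟩ := hp' w'
      exact ⟨π (0, x'), hs _⟩

lemma HasAddCoresolution.left [Module.Injective Λ J] {t : ℕ} {i : K →ₗ[Λ] Y} {q : Y →ₗ[Λ] Z}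
    (hi : Function.Injective i) (hiq : Function.Exact i q) (hq : Function.Surjective q)
    (hY : HasAddCoresolution Λ J (t + 1) Y) (hZ : HasAddCoresolution Λ J t Z) :
    HasAddCoresolution Λ J (t + 1) K := by
  obtain ⟨X, W, a, p, hX, ha, hap, hp, hW⟩ := hY
  let b : K →ₗ[Λ] X := a ∘ₗ i
  let π := (LinearMap.range b).mkQ
  have hπ : Function.Surjective π := Submodule.mkQ_surjective _
  have hbπ : Function.Exact b π := LinearMap.exact_map_mkQ_range b
  obtain ⟨r, hr⟩ := LinearMap.exists_factor hq (π ∘ₗ a) fun y hy => by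
    obtain ⟨z, rfl⟩ := (hiq y).mp hy
    exact hbπ.apply_apply_eq_zero z
  obtain ⟨s, hs⟩ := LinearMap.exists_factor hπ p fun x hx => by
    obtain ⟨y, rfl⟩ := (hbπ x).mp hx
    exact hap.apply_apply_eq_zero (i y)
  refine ⟨X, ModuleCat.of Λ (X ⧸ LinearMap.range b), b, π, hX, ha.comp hi, hbπ, hπ,
    HasAddCoresolution.middle (i := r) (q := s) ?_ ?_ ?_ hZ hW⟩
  · rw [injective_iff_map_eq_zero]
    intro z hz
    obtain ⟨y, rfl⟩ := hq z
    rw [hr] at hz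
    obtain ⟨k, hk⟩ := (hbπ _).mp hz
    rw [← ha hk, hiq.apply_apply_eq_zero]
  · intro w
    obtain ⟨x, rfl⟩ := hπ w
    rw [hs, hap x]
    constructor
    · rintro ⟨y, rfl⟩
      exact ⟨q y, hr y⟩
    · rintro ⟨z, hz⟩
      obtain ⟨y, rfl⟩ := hq z
      rw [hr, LinearMap.comp_apply, ← sub_eq_zero, ← map_sub] at hz
      obtain ⟨k, hk⟩ := (hbπ _).mp hz
      refine ⟨y - i k, ?_⟩
      rw [map_sub, show a (i k) = _ from hk]
      abel
  · intro w
    obtain ⟨x, rfl⟩ := hp w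
    exact ⟨π x, hs x⟩

end AddCoresolution

section InjectiveCogenerator

variable {R : Type u} [CommRing R]

/-- If `S` is a finitely generated essential submodule of `Q`, then `Hom(X, Q)` is finitely
generated for every module `X` of finite length. -/
lemma Module.Finite.linearMap_of_essential [IsNoetherianRing R] {Q : Type u} [AddCommGroup Q]
    [Module R Q] (S : Submodule R Q) [Module.Finite R S]
    (hS : ∀ N : Submodule R Q, Disjoint N S → N = ⊥)
    {X : Type u} [AddCommGroup X] [Module R X] (hX : IsFiniteLength R X) :
    Module.Finite R (X →ₗ[R] Q) := by
  have simple (V : Type u) [AddCommGroup V] [Module R V] [IsSimpleModule R V] :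
      Module.Finite R (V →ₗ[R] Q) := by
    have := IsSimpleModule.nontrivial R V
    obtain ⟨v, hv⟩ := exists_ne (0 : V)
    have hmem (φ : V →ₗ[R] Q) : φ v ∈ S := by
      rcases eq_bot_or_eq_top (S.comap φ) with h | h
      · have hr : LinearMap.range φ = ⊥ := hS _ <| by
          rw [Submodule.disjoint_def]
          rintro _ ⟨w, rfl⟩ hw
          have hw' : w ∈ S.comap φ := hw
          rw [h, Submodule.mem_bot] at hw'
          rw [hw', map_zero]
        rw [LinearMap.range_eq_bot.mp hr]
        exact S.zero_mem
      · exact (h ▸ Submodule.mem_top : v ∈ S.comap φ)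
    refine Module.Finite.of_injective
      (LinearMap.codRestrict S (LinearMap.applyₗ v) hmem) fun φ ψ h => ?_
    have h' : φ v = ψ v := congrArg Subtype.val h
    rcases LinearMap.injective_or_eq_zero (φ - ψ) with h0 | h0
    · exact absurd (h0 (by simp [h'])) hv
    · exact sub_eq_zero.mp h0
  induction hX with
  | of_subsingleton => infer_instance
  | @of_simple_quotient X _ _ N _ hN ih =>
    have := simple (X ⧸ N)
    have : IsNoetherian R (X →ₗ[R] Q) := isNoetherian_of_range_eq_ker
      (LinearMap.lcomp R Q N.mkQ) (LinearMap.lcomp R Q N.subtype) <| by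
        ext φ
        rw [LinearMap.mem_range, LinearMap.mem_ker]
        constructor
        · rintro ⟨ψ, rfl⟩
          ext x
          simp [(Submodule.Quotient.mk_eq_zero N).mpr x.2]
        · intro h
          have hle : N ≤ LinearMap.ker φ := fun x hx => LinearMap.congr_fun h ⟨x, hx⟩
          exact ⟨N.liftQ φ hle, N.liftQ_mkQ φ hle⟩
    infer_instance

lemma Submodule.exists_maximal_disjoint {I : Type u} [AddCommGroup I] [Module R I]
    (S : Submodule R I) : ∃ C : Submodule R I, Maximal (fun C => Disjoint C S) C := by
  refine zorn_le₀ {C | Disjoint C S} fun c hc hchain =>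
    ⟨sSup c, ?_, fun C hC => le_sSup hC⟩
  exact (DirectedOn.disjoint_sSup_left hchain.directedOn).mpr fun C hC => hc hC

theorem exists_finite_injective_cogenerator (R : Type u) [CommRing R] [IsArtinianRing R] :
    ∃ E : ModuleCat.{u} R, Module.Finite R E ∧ Module.Injective R E ∧
      ∀ (X : Type u) [AddCommGroup X] [Module R X] (x : X), x ≠ 0 →
        ∃ φ : X →ₗ[R] E, φ x ≠ 0 := by
  classical
  let S := ∀ m : MaximalSpectrum R, R ⧸ m.asIdeal
  let I : ModuleCat.{u} R := Injective.under (ModuleCat.of R S)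
  have hI : Module.Injective R I := (Module.injective_iff_injective_object R I).mpr
    (inferInstanceAs (Injective (Injective.under (ModuleCat.of R S))))
  let ι : S →ₗ[R] I := (Injective.ι (ModuleCat.of R S)).hom
  have hι : Function.Injective ι :=
    (ModuleCat.mono_iff_injective (Injective.ι (ModuleCat.of R S))).mp inferInstance
  obtain ⟨C, hC, hmax⟩ := Submodule.exists_maximal_disjoint (LinearMap.range ι)
  rw [Submodule.disjoint_def] at hC
  let Q := (I : Type u) ⧸ C
  let j : S →ₗ[R] Q := C.mkQ ∘ₗ ι
  have hιC (s : S) (hs : ι s ∈ C) : s = 0 :=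
    (map_eq_zero_iff ι hι).mp (hC _ hs ⟨s, rfl⟩)
  have hj : Function.Injective j := by
    rw [injective_iff_map_eq_zero]
    exact fun s hs => hιC s ((Submodule.Quotient.mk_eq_zero C).mp hs)
  have hess (N : Submodule R Q) (hN : Disjoint N (LinearMap.range j)) : N = ⊥ := by
    rw [Submodule.disjoint_def] at hN
    have hle : N.comap C.mkQ ≤ C := by
      refine hmax (y := N.comap C.mkQ) ?_ fun x hx => ?_
      · refine Submodule.disjoint_def.mpr ?_
        rintro _ hx ⟨s, rfl⟩
        have hs : j s = 0 := hN _ hx ⟨s, rfl⟩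
        rw [(map_eq_zero_iff j hj).mp hs, map_zero]
      · rw [Submodule.mem_comap, Submodule.mkQ_apply, (Submodule.Quotient.mk_eq_zero C).mpr hx]
        exact N.zero_mem
    rw [eq_bot_iff]
    intro y hy
    obtain ⟨x, rfl⟩ := C.mkQ_surjective y
    exact (Submodule.Quotient.mk_eq_zero C).mpr (hle hy)
  have hker {V : Type u} [AddCommGroup V] [Module R V] (f : Q →ₗ[R] V)
      (hf : ∀ s, f (j s) = 0 → s = 0) : Function.Injective f := by
    rw [← LinearMap.ker_eq_bot]
    refine hess _ ?_
    rw [Submodule.disjoint_def]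
    rintro _ hx ⟨s, rfl⟩
    rw [hf s hx, map_zero]
  have hQfin : Module.Finite R Q := by
    have hR : IsFiniteLength R R :=
      isFiniteLength_iff_isNoetherian_isArtinian.mpr ⟨inferInstance, inferInstance⟩
    have := Module.Finite.linearMap_of_essential (LinearMap.range j) hess hR
    exact Module.Finite.equiv (LinearMap.ringLmapEquivSelf R R Q)
  have hQinj : Module.Injective R Q := by
    obtain ⟨h, hh⟩ := hI.out j hj ι
    have hinj : Function.Injective (C.mkQ ∘ₗ h) := hker _ fun s hs => by
      rw [LinearMap.comp_apply, hh] at hs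
      exact hιC s ((Submodule.Quotient.mk_eq_zero C).mp hs)
    let e : Q ≃ₗ[R] Q := LinearEquiv.ofBijective (C.mkQ ∘ₗ h)
      (IsArtinian.bijective_of_injective_endomorphism _ hinj)
    have hadd : InAdd R I Q := InAdd.of_retract h (e.symm.toLinearMap ∘ₗ C.mkQ)
      (LinearMap.ext fun x => e.symm_apply_apply x)
    exact hadd.injective
  refine ⟨ModuleCat.of R Q, hQfin, hQinj, fun X _ _ x hx => ?_⟩
  have hann : LinearMap.ker (LinearMap.toSpanSingleton R X x) ≠ ⊤ := by
    intro h
    apply hx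
    have : (1 : R) ∈ LinearMap.ker (LinearMap.toSpanSingleton R X x) := h ▸ Submodule.mem_top
    simpa using this
  obtain ⟨m, hm, hle⟩ := Ideal.exists_le_maximal _ hann
  let f : R →ₗ[R] Q := j ∘ₗ LinearMap.single R (fun m : MaximalSpectrum R => R ⧸ m.asIdeal) ⟨m, hm⟩
    ∘ₗ m.mkQ
  obtain ⟨f', hf'⟩ := LinearMap.exists_factor
    (LinearMap.toSpanSingleton R X x).surjective_rangeRestrict f fun r hr => by
      have : r ∈ m := hle (congrArg Subtype.val hr)
      have h0 : m.mkQ r = 0 := (Submodule.Quotient.mk_eq_zero m).mpr this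
      simp [f, h0]
  obtain ⟨φ, hφ⟩ := hQinj.out (LinearMap.range (LinearMap.toSpanSingleton R X x)).subtype
    (Submodule.injective_subtype _) f'
  refine ⟨φ, fun h0 => ?_⟩
  have h1 : f 1 = 0 := by
    rw [← hf', ← hφ]
    simpa using h0
  have h2 := (map_eq_zero_iff j hj).mp h1
  have h3 : m.mkQ 1 = 0 := 
    (Pi.single_eq_same (M := fun m : MaximalSpectrum R => R ⧸ m.asIdeal) ⟨m, hm⟩ _).symm.trans
      (congrFun h2 ⟨m, hm⟩)
  exact (Ideal.ne_top_iff_one m).mp hm.ne_top ((Submodule.Quotient.mk_eq_zero m).mp h3)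

end InjectiveCogenerator

section HomModules

/-- The right action of `S` on `Hom_K(N, Y)` induced by a left action of `S` on `N`. -/
instance linearMapOppositeModule {K S N Y : Type*} [Ring K] [Ring S] [AddCommGroup N] [Module K N]
    [Module S N] [SMulCommClass K S N] [AddCommGroup Y] [Module K Y] :
    Module Sᵐᵒᵖ (N →ₗ[K] Y) where
  smul s φ :=
    { toFun := fun x => φ (s.unop • x)
      map_add' := fun x y => by rw [smul_add, map_add]
      map_smul' := fun k x => by rw [← smul_comm, map_smul, RingHom.id_apply] }
  one_smul φ := LinearMap.ext fun x => congrArg φ (one_smul S x)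
  mul_smul s t φ := LinearMap.ext fun x => congrArg φ (mul_smul t.unop s.unop x)
  smul_zero _ := rfl
  smul_add _ _ _ := rfl
  add_smul s t φ := LinearMap.ext fun x =>
    (congrArg φ (add_smul s.unop t.unop x)).trans (map_add φ _ _)
  zero_smul φ := LinearMap.ext fun x => (congrArg φ (zero_smul S x)).trans (map_zero φ)

lemma Module.Finite.linearMap_of_isNoetherianRing (R : Type*) [CommRing R] [IsNoetherianRing R]
    {A X Y : Type*} [Ring A] [AddCommGroup X] [Module A X] [Module.Finite A X]
    [AddCommGroup Y] [Module A Y] [Module R Y] [SMulCommClass A R Y] [Module.Finite R Y] :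
    Module.Finite R (X →ₗ[A] Y) := by
  obtain ⟨k, p, hp⟩ := Module.Finite.exists_fin' A X
  let F : (X →ₗ[A] Y) →ₗ[R] (Fin k → Y) :=
    { toFun := fun φ i => φ (p (Pi.single i 1))
      map_add' := fun _ _ => rfl
      map_smul' := fun _ _ => rfl }
  refine Module.Finite.of_injective F fun φ ψ h => ?_
  have h1 : φ ∘ₗ p = ψ ∘ₗ p := by
    ext i
    simpa [F] using congrFun h i
  exact LinearMap.ext fun x => by
    obtain ⟨y, rfl⟩ := hp x
    exact LinearMap.congr_fun h1 y

lemma Module.Injective.exists_comp_eq {R E V W : Type u} [Ring R] [AddCommGroup E] [Module R E]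
    [hE : Module.Injective R E] [AddCommGroup V] [Module R V] [AddCommGroup W] [Module R W]
    (b : V →ₗ[R] W) (τ : V →ₗ[R] E) (h : ∀ v, b v = 0 → τ v = 0) : ∃ σ : W →ₗ[R] E, σ ∘ₗ b = τ := by
  obtain ⟨τ', hτ'⟩ := LinearMap.exists_factor b.surjective_rangeRestrict τ fun v hv =>
    h v (congrArg Subtype.val hv)
  obtain ⟨σ, hσ⟩ := hE.out (LinearMap.range b).subtype (Submodule.injective_subtype _) τ'
  exact ⟨σ, LinearMap.ext fun v => by rw [← hτ', ← hσ]; rfl⟩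

/-- The coinduced left `A`-module `Hom_R(A, E)`. -/
def Coinduced (R A E : Type u) [CommRing R] [Ring A] [Algebra R A] [AddCommGroup E] [Module R E] :
    Type u := A →ₗ[R] E

section Coinduced

variable (R A E : Type u) [CommRing R] [Ring A] [Algebra R A] [AddCommGroup E] [Module R E]

noncomputable instance : AddCommGroup (Coinduced R A E) :=
  inferInstanceAs (AddCommGroup (A →ₗ[R] E))

noncomputable instance : Module R (Coinduced R A E) := inferInstanceAs (Module R (A →ₗ[R] E))

instance : FunLike (Coinduced R A E) A E := inferInstanceAs (FunLike (A →ₗ[R] E) A E)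

instance : LinearMapClass (Coinduced R A E) R A E :=
  inferInstanceAs (LinearMapClass (A →ₗ[R] E) R A E)

variable {R A E} in
@[ext] lemma Coinduced.ext {φ ψ : Coinduced R A E} (h : ∀ a, φ a = ψ a) : φ = ψ :=
  LinearMap.ext h

noncomputable instance : Module A (Coinduced R A E) where
  smul a φ := φ.comp (LinearMap.mulRight R a)
  one_smul φ := Coinduced.ext fun b => congrArg φ (mul_one b)
  mul_smul a b φ := Coinduced.ext fun c => congrArg φ (mul_assoc c a b).symm
  smul_zero _ := rfl
  smul_add _ _ _ := rfl
  add_smul a b φ := Coinduced.ext fun c =>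
    (congrArg φ (mul_add c a b)).trans (map_add φ _ _)
  zero_smul φ := Coinduced.ext fun c => (congrArg φ (mul_zero c)).trans (map_zero φ)

lemma Coinduced.smul_apply (a b : A) (φ : Coinduced R A E) : (a • φ) b = φ (b * a) := rfl

instance : IsScalarTower R A (Coinduced R A E) where
  smul_assoc r a φ := Coinduced.ext fun b => by
    refine (congrArg φ (mul_smul_comm r b a)).trans ?_
    exact map_smul φ r (b * a)

variable {R A E}

/-- The `A`-linear map to a coinduced module corresponding to an `R`-linear map. -/
def Coinduced.lift {V : Type u} [AddCommGroup V] [Module A V] [Module R V] [IsScalarTower R A V]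
    (h : V →ₗ[R] E) : V →ₗ[A] Coinduced R A E where
  toFun v := h ∘ₗ (LinearMap.toSpanSingleton A V v).restrictScalars R
  map_add' v w := Coinduced.ext fun a => by
    change h (a • (v + w)) = h (a • v) + h (a • w)
    rw [smul_add, map_add]
  map_smul' a v := Coinduced.ext fun b => by
    change h (b • a • v) = h ((b * a) • v)
    rw [mul_smul]

lemma Coinduced.lift_apply {V : Type u} [AddCommGroup V] [Module A V] [Module R V]
    [IsScalarTower R A V] (h : V →ₗ[R] E) (v : V) (a : A) : Coinduced.lift h v a = h (a • v) := rfl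

instance Coinduced.injective [hE : Module.Injective R E] :
    Module.Injective A (Coinduced R A E) := by
  refine ⟨fun U V _ _ _ _ f hf g => ?_⟩
  let _ : Module R U := Module.compHom U (algebraMap R A)
  let _ : Module R V := Module.compHom V (algebraMap R A)
  have : IsScalarTower R A U := IsScalarTower.of_algebraMap_smul fun r x => rfl
  have : IsScalarTower R A V := IsScalarTower.of_algebraMap_smul fun r x => rfl
  let ev : U →ₗ[R] E :=
    { toFun := fun x => g x 1
      map_add' := fun x y => by rw [map_add]; rfl
      map_smul' := fun r x => by
        rw [← algebraMap_smul A r x, map_smul, Coinduced.smul_apply, one_mul,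
          Algebra.algebraMap_eq_smul_one, map_smul, RingHom.id_apply] }
  obtain ⟨h, hh⟩ := hE.out (f.restrictScalars R) hf ev
  refine ⟨Coinduced.lift h, fun x => Coinduced.ext fun a => ?_⟩
  rw [Coinduced.lift_apply, ← map_smul]
  refine (hh (a • x)).trans ?_
  change g (a • x) 1 = _
  rw [map_smul, Coinduced.smul_apply, one_mul]

instance Coinduced.finite [IsNoetherianRing R] [Module.Finite R A] [Module.Finite R E] :
    Module.Finite A (Coinduced R A E) := by
  have : Module.Finite R (Coinduced R A E) :=
    Module.Finite.linearMap_of_isNoetherianRing R (X := A) (Y := E)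
  exact Module.Finite.of_restrictScalars_finite R A _

/-- Coinducing an injective cogenerator gives a module into whose powers all Artinian modules
embed. -/
lemma Coinduced.exists_injective
    (hE : ∀ (X : Type u) [AddCommGroup X] [Module R X] (x : X), x ≠ 0 →
        ∃ φ : X →ₗ[R] E, φ x ≠ 0)
    (X : Type u) [AddCommGroup X] [Module A X] [IsArtinian A X] :
    ∃ (k : ℕ) (F : X →ₗ[A] (Fin k → Coinduced R A E)), Function.Injective F := by
  let _ : Module R X := Module.compHom X (algebraMap R A)
  have : IsScalarTower R A X := IsScalarTower.of_algebraMap_smul fun r x => rfl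
  obtain ⟨N, ⟨k, F, rfl⟩, hmin⟩ := IsArtinian.set_has_minimal
    {N : Submodule A X | ∃ (k : ℕ) (F : X →ₗ[A] (Fin k → Coinduced R A E)), LinearMap.ker F = N}
    ⟨_, 0, 0, rfl⟩
  refine ⟨k, F, ?_⟩
  rw [← LinearMap.ker_eq_bot, Submodule.eq_bot_iff]
  by_contra! hne
  obtain ⟨x, hx, hx0⟩ := hne
  obtain ⟨φ, hφ⟩ := hE X x hx0
  let G : X →ₗ[A] (Fin (k + 1) → Coinduced R A E) :=
    LinearMap.pi (Fin.cons (Coinduced.lift φ) fun i => LinearMap.proj i ∘ₗ F)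
  refine hmin (LinearMap.ker G) ⟨_, G, rfl⟩ ?_
  refine lt_of_le_of_ne (fun y hy => ?_) fun h => ?_
  · exact funext fun i => congrFun (show G y = 0 from hy) i.succ
  · rw [← h] at hx
    have h0 : (Coinduced.lift φ : X →ₗ[A] Coinduced R A E) x = 0 :=
      congrFun (show G x = 0 from hx) 0
    have h1 : (Coinduced.lift φ : X →ₗ[A] Coinduced R A E) x (1 : A) = 0 := by rw [h0]; rfl
    rw [Coinduced.lift_apply, one_smul] at h1
    exact hφ h1

end Coinduced

section DualHom

variable (R A : Type u) [CommRing R] [Ring A] [Algebra R A]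
  (M E : Type u) [AddCommGroup M] [Module A M] [Module R M] [IsScalarTower R A M]
  [AddCommGroup E] [Module R E]

/-- The right `End_A(M)`-module `Hom_R(Hom_A(X, M), E)`. -/
abbrev DualHom (X : Type u) [AddCommGroup X] [Module A X] : Type u := (X →ₗ[A] M) →ₗ[R] E

variable {A} {X X' W : Type u} [AddCommGroup X] [Module A X] [AddCommGroup X'] [Module A X']
  [AddCommGroup W] [Module A W]

/-- Precomposition as an `R`-linear map. -/
def precompLinear (f : X →ₗ[A] X') : (X' →ₗ[A] M) →ₗ[R] (X →ₗ[A] M) where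
  toFun φ := φ ∘ₗ f
  map_add' _ _ := rfl
  map_smul' _ _ := rfl

/-- Functoriality of `DualHom`. -/
def DualHom.map (f : X →ₗ[A] X') :
    DualHom R A M E X →ₗ[(Module.End A M)ᵐᵒᵖ] DualHom R A M E X' where
  toFun τ := τ ∘ₗ precompLinear R M f
  map_add' _ _ := rfl
  map_smul' _ _ := rfl

lemma DualHom.map_apply (f : X →ₗ[A] X') (τ : DualHom R A M E X) (φ : X' →ₗ[A] M) :
    DualHom.map R M E f τ φ = τ (φ ∘ₗ f) := rfl

lemma InAdd.dualHom (h : InAdd A W X) :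
    InAdd (Module.End A M)ᵐᵒᵖ (DualHom R A M E W) (DualHom R A M E X) := by
  obtain ⟨k, a, b, hab⟩ := h.exists_sum_eq_id
  refine InAdd.of_sum_eq_id (fun i => DualHom.map R M E (a i)) (fun i => DualHom.map R M E (b i)) ?_
  refine LinearMap.ext fun τ => LinearMap.ext fun φ => ?_
  rw [LinearMap.sum_apply, LinearMap.sum_apply]
  simp only [LinearMap.comp_apply, DualHom.map_apply]
  rw [← map_sum, LinearMap.id_apply]
  congr 1
  conv_rhs => rw [← LinearMap.comp_id φ, ← hab]
  ext x
  simp [LinearMap.sum_apply]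

lemma DualHom.map_injective {f : X →ₗ[A] X'}
    (hf : Function.Surjective fun φ : X' →ₗ[A] M => φ ∘ₗ f) :
    Function.Injective (DualHom.map R M E f) := by
  rw [injective_iff_map_eq_zero]
  intro τ hτ
  refine LinearMap.ext fun φ => ?_
  obtain ⟨ψ, rfl⟩ := hf φ
  exact LinearMap.congr_fun hτ ψ

lemma DualHom.map_surjective [Module.Injective R E] {f : X →ₗ[A] X'} (hf : Function.Surjective f) :
    Function.Surjective (DualHom.map R M E f) := by
  intro τ
  refine Module.Injective.exists_comp_eq (precompLinear R M f) τ fun φ hφ => ?_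
  have : φ = 0 := LinearMap.ext fun x => by
    obtain ⟨y, rfl⟩ := hf x
    exact LinearMap.congr_fun hφ y
  rw [this, map_zero]

lemma DualHom.map_exact [Module.Injective R E] {f : W →ₗ[A] X} {g : X →ₗ[A] X'}
    (h : Function.Exact (fun φ : X' →ₗ[A] M => φ ∘ₗ g) (fun φ : X →ₗ[A] M => φ ∘ₗ f)) :
    Function.Exact (DualHom.map R M E f) (DualHom.map R M E g) := by
  intro τ
  constructor
  · intro hτ
    refine Module.Injective.exists_comp_eq (precompLinear R M f) τ fun φ hφ => ?_
    obtain ⟨ψ, rfl⟩ := (h φ).mp hφ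
    exact LinearMap.congr_fun hτ ψ
  · rintro ⟨σ, rfl⟩
    refine LinearMap.ext fun φ => ?_
    have : (φ ∘ₗ g) ∘ₗ f = 0 := (h _).mpr ⟨φ, rfl⟩
    rw [DualHom.map_apply, DualHom.map_apply, this, map_zero, LinearMap.zero_apply]

lemma DualHom.map_exact_of_exact [Module.Injective R E] {f : W →ₗ[A] X} {g : X →ₗ[A] X'}
    (h : Function.Exact f g) (hg : Function.Surjective g) :
    Function.Exact (DualHom.map R M E f) (DualHom.map R M E g) := by
  refine DualHom.map_exact R M E fun φ => ?_
  constructor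
  · intro hφ
    obtain ⟨ψ, hψ⟩ := LinearMap.exists_factor hg φ fun x hx => by
      obtain ⟨w, rfl⟩ := (h x).mp hx
      exact LinearMap.congr_fun hφ w
    exact ⟨ψ, LinearMap.ext hψ⟩
  · rintro ⟨ψ, rfl⟩
    refine LinearMap.ext fun w => ?_
    simp [h.apply_apply_eq_zero w]

instance DualHom.injective_self [Module.Injective R E] :
    Module.Injective (Module.End A M)ᵐᵒᵖ (DualHom R A M E M) := by
  let e : DualHom R A M E M →ₗ[(Module.End A M)ᵐᵒᵖ] Coinduced R (Module.End A M)ᵐᵒᵖ E :=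
    { toFun := fun τ => τ ∘ₗ (MulOpposite.opLinearEquiv R).symm.toLinearMap
      map_add' := fun _ _ => rfl
      map_smul' := fun _ _ => rfl }
  let e' : Coinduced R (Module.End A M)ᵐᵒᵖ E →ₗ[(Module.End A M)ᵐᵒᵖ] DualHom R A M E M :=
    { toFun := fun τ => LinearMap.comp τ (MulOpposite.opLinearEquiv R).toLinearMap
      map_add' := fun _ _ => rfl
      map_smul' := fun _ _ => rfl }
  exact (InAdd.of_retract e e' rfl).injective

lemma DualHom.finite [IsNoetherianRing R] [Module.Finite R M] [Module.Finite R E]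
    [Module.Finite A X] : Module.Finite (Module.End A M)ᵐᵒᵖ (DualHom R A M E X) := by
  have : Module.Finite R (X →ₗ[A] M) := Module.Finite.linearMap_of_isNoetherianRing R
  have : Module.Finite R (DualHom R A M E X) := Module.Finite.linearMap_of_isNoetherianRing R
  have : IsScalarTower R (Module.End A M)ᵐᵒᵖ (DualHom R A M E X) :=
    ⟨fun r a τ => LinearMap.ext fun φ => map_smul τ r (a.unop • φ)⟩
  exact Module.Finite.of_restrictScalars_finite R (Module.End A M)ᵐᵒᵖ _

/-- The adjunction isomorphism `Hom_A(M, Hom_R(A, E)) ≅ Hom_R(Hom_A(A, M), E)`. -/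
noncomputable def homCoinducedEquiv :
    (M →ₗ[A] Coinduced R A E) ≃ₗ[(Module.End A M)ᵐᵒᵖ] DualHom R A M E A where
  toFun ψ :=
    { toFun := fun φ => ψ (φ 1) 1
      map_add' := fun φ φ' => by rw [LinearMap.add_apply, map_add]; rfl
      map_smul' := fun r φ => by
        rw [LinearMap.smul_apply, ← algebraMap_smul A r (φ 1), map_smul, Coinduced.smul_apply,
          one_mul, Algebra.algebraMap_eq_smul_one, map_smul, RingHom.id_apply] }
  map_add' _ _ := rfl
  map_smul' _ _ := rfl
  invFun τ := Coinduced.lift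
    { toFun := fun x => τ (LinearMap.toSpanSingleton A M x)
      map_add' := fun x y => by
        rw [← map_add]
        congr 1
        ext
        simp
      map_smul' := fun r x => by
        rw [RingHom.id_apply, ← map_smul]
        congr 1
        ext
        simp }
  left_inv ψ := LinearMap.ext fun x => Coinduced.ext fun a => by
    rw [Coinduced.lift_apply]
    change ψ (LinearMap.toSpanSingleton A M (a • x) 1) 1 = ψ x a
    rw [LinearMap.toSpanSingleton_apply, one_smul, map_smul, Coinduced.smul_apply, one_mul]
  right_inv τ := LinearMap.ext fun φ => by
    change τ (LinearMap.toSpanSingleton A M ((1 : A) • φ 1)) = τ φ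
    congr 1
    ext
    simp

end DualHom

section PostComp

variable {A : Type u} [Ring A] (M : Type u) [AddCommGroup M] [Module A M]
  {Y Y' Z : Type u} [AddCommGroup Y] [Module A Y] [AddCommGroup Y'] [Module A Y']
  [AddCommGroup Z] [Module A Z]

/-- Postcomposition as a map of right `End_A(M)`-modules. -/
def postcompLinear (f : Y →ₗ[A] Y') :
    (M →ₗ[A] Y) →ₗ[(Module.End A M)ᵐᵒᵖ] (M →ₗ[A] Y') where
  toFun φ := f ∘ₗ φ
  map_add' φ ψ := LinearMap.comp_add φ ψ f
  map_smul' _ _ := rfl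

lemma postcompLinear_apply (f : Y →ₗ[A] Y') (φ : M →ₗ[A] Y) :
    postcompLinear M f φ = f ∘ₗ φ := rfl

lemma InAdd.hom {W X : Type u} [AddCommGroup W] [Module A W] [AddCommGroup X] [Module A X]
    (h : InAdd A W X) : InAdd (Module.End A M)ᵐᵒᵖ (M →ₗ[A] W) (M →ₗ[A] X) := by
  obtain ⟨k, a, b, hab⟩ := h.exists_sum_eq_id
  refine InAdd.of_sum_eq_id (fun i => postcompLinear M (a i)) (fun i => postcompLinear M (b i)) ?_
  refine LinearMap.ext fun φ => LinearMap.ext fun x => ?_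
  have := LinearMap.congr_fun hab (φ x)
  simpa [LinearMap.sum_apply, postcompLinear_apply] using this

lemma postcompLinear_injective {f : Y →ₗ[A] Y'} (hf : Function.Injective f) :
    Function.Injective (postcompLinear M f) := fun _ _ h =>
  LinearMap.ext fun x => hf (LinearMap.congr_fun h x)

lemma postcompLinear_exact {f : Y →ₗ[A] Y'} {g : Y' →ₗ[A] Z} (hf : Function.Injective f)
    (h : Function.Exact f g) : Function.Exact (postcompLinear M f) (postcompLinear M g) := by
  intro φ
  constructor
  · intro hφ
    have hr (x : M) : φ x ∈ LinearMap.range f := (h _).mp (LinearMap.congr_fun hφ x)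
    let e := LinearEquiv.ofInjective f hf
    refine ⟨e.symm.toLinearMap ∘ₗ φ.codRestrict (LinearMap.range f) hr, LinearMap.ext fun x => ?_⟩
    exact congrArg Subtype.val (e.apply_symm_apply ⟨φ x, hr x⟩)
  · rintro ⟨ψ, rfl⟩
    exact LinearMap.ext fun x => h.apply_apply_eq_zero (ψ x)

/-- `Hom_A(M, -)` commutes with finite powers. -/
def homPiEquiv (k : ℕ) :
    (M →ₗ[A] (Fin k → Y)) ≃ₗ[(Module.End A M)ᵐᵒᵖ] (Fin k → (M →ₗ[A] Y)) where
  toFun φ i := LinearMap.proj i ∘ₗ φ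
  map_add' _ _ := rfl
  map_smul' _ _ := rfl
  invFun φ := LinearMap.pi φ
  left_inv _ := rfl
  right_inv _ := rfl

/-- The regular right module is `Hom_A(M, M)`. -/
def endOppositeEquiv : (Module.End A M)ᵐᵒᵖ ≃ₗ[(Module.End A M)ᵐᵒᵖ] (M →ₗ[A] M) where
  toFun a := a.unop
  map_add' _ _ := rfl
  map_smul' _ _ := rfl
  invFun a := MulOpposite.op a
  left_inv _ := rfl
  right_inv _ := rfl

end PostComp

end HomModules

section Coresolution

variable (R : Type u) {A : Type u} [CommRing R] [Ring A] [Algebra R A]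
  (M E : Type u) [AddCommGroup M] [Module A M] [Module R M] [IsScalarTower R A M]
  [AddCommGroup E] [Module R E]

lemma InAdd.of_isCogenerator {I : Type u} [AddCommGroup I] [Module A I] [Module.Finite A I]
    [hI : Module.Injective A I] (hcog : IsCogenerator A M) : InAdd A M I := by
  obtain ⟨k, f, hf⟩ := hcog I inferInstance
  obtain ⟨r, hr⟩ := hI.out f hf LinearMap.id
  exact ⟨k, f, r, LinearMap.ext hr⟩

lemma DualHom.projective_self [IsNoetherianRing R] [Module.Finite R A] [Module.Finite R E]
    [Module.Injective R E] (hcog : IsCogenerator A M) :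
    Module.Projective (Module.End A M)ᵐᵒᵖ (DualHom R A M E A) := by
  have h : InAdd A M (Coinduced R A E) := InAdd.of_isCogenerator M hcog
  have : Module.Projective (Module.End A M)ᵐᵒᵖ (M →ₗ[A] M) :=
    Module.Projective.of_equiv (endOppositeEquiv M)
  have := (h.hom M).projective
  exact Module.Projective.of_equiv (homCoinducedEquiv R M E)

lemma InAdd.of_projective {X : Type u} [AddCommGroup X] [Module A X] [Module.Finite A X]
    [Module.Projective A X] : InAdd A A X := by
  obtain ⟨k, p, hp⟩ := Module.Finite.exists_fin' A X
  obtain ⟨s, hs⟩ := Module.projective_lifting_property p LinearMap.id hp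
  exact ⟨k, s, p, hs⟩

lemma ExtVanishes.of_inAdd {W X Y : Type u} [AddCommGroup W] [Module A W] [AddCommGroup X]
    [Module A X] [AddCommGroup Y] [Module A Y] (h : InAdd A W X) {j : ℕ}
    (hW : ExtVanishes A W Y j) : ExtVanishes A X Y j := by
  obtain ⟨k, a, b, hab⟩ := h.exists_sum_eq_id
  exact ExtVanishes.of_sum_eq_id a b hab fun _ => hW

lemma DualHom.projDimLE [IsNoetherianRing A] [Module.Injective R E]
    [Module.Projective (Module.End A M)ᵐᵒᵖ (DualHom R A M E A)] (d : ℕ)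
    {X : Type u} [AddCommGroup X] [Module A X] [Module.Finite A X]
    (hX : ∀ (Y : Type u) [AddCommGroup Y] [Module A Y], ExtVanishes A X Y (d + 1))
    (hM : ∀ i, 1 ≤ i → i ≤ d → ExtVanishes A X M i) :
    ProjDimLE (Module.End A M)ᵐᵒᵖ (DualHom R A M E X) d := by
  induction d generalizing X with
  | zero =>
    have := Module.Projective.of_extVanishes_one hX
    have := ((InAdd.of_projective (A := A) (X := X)).dualHom R M E).projective
    exact ProjDimLE.of_projective 0
  | succ d ih =>
    obtain ⟨k, p, hp⟩ := Module.Finite.exists_fin' A X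
    have hi := (LinearMap.ker p).injective_subtype
    have hip := LinearMap.exact_subtype_ker_map p
    have : Module.Projective A (Fin k → A) :=
      Module.Projective.of_equiv (DFinsupp.linearEquivFunOnFintype (M := fun _ : Fin k => A))
    have := ((InAdd.of_projective (A := A) (X := Fin k → A)).dualHom R M E).projective
    refine ProjDimLE.of_shortExact (i := DualHom.map R M E (LinearMap.ker p).subtype)
      (p := DualHom.map R M E p) (DualHom.map_injective R M E fun φ => ?_)
      (DualHom.map_exact_of_exact R M E hip hp) (DualHom.map_surjective R M E hp)
      (ih (fun Y _ _ => ?_) fun i hi1 hid => ?_)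
    · exact ExtVanishes.exists_extend hi hip hp (hM 1 le_rfl (by omega)) φ
    · exact ExtVanishes.of_contravariant_left hi hip hp (ExtVanishes.of_projective d) (hX Y)
    · obtain ⟨i, rfl⟩ := Nat.exists_eq_add_of_le' hi1
      exact ExtVanishes.of_contravariant_left hi hip hp (ExtVanishes.of_projective i)
        (hM _ (by omega) (by omega))

lemma HasAddCoresolution.hom [IsArtinianRing A] [Module.Injective R E]
    (hE : ∀ (X : Type u) [AddCommGroup X] [Module R X] (x : X), x ≠ 0 →
        ∃ φ : X →ₗ[R] E, φ x ≠ 0)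
    [Module.Finite A (Coinduced R A E)]
    {J : Type u} [AddCommGroup J] [Module (Module.End A M)ᵐᵒᵖ J]
    [Module.Injective (Module.End A M)ᵐᵒᵖ J]
    (hJ : ∀ t, HasAddCoresolution (Module.End A M)ᵐᵒᵖ J t (DualHom R A M E A)) (t : ℕ)
    {Y : Type u} [AddCommGroup Y] [Module A Y] [Module.Finite A Y]
    (hY : ∀ i, 1 ≤ i → i + 1 ≤ t → ExtVanishes A M Y i) :
    HasAddCoresolution (Module.End A M)ᵐᵒᵖ J (t + 1) (M →ₗ[A] Y) := by
  induction t generalizing Y with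
  | zero =>
    obtain ⟨k, F, hF⟩ := Coinduced.exists_injective (A := A) hE Y
    exact ((((hJ 1).of_equiv (homCoinducedEquiv R M E)).pi k).of_equiv
      (homPiEquiv M k)).of_injective (postcompLinear_injective M hF)
  | succ t ih =>
    obtain ⟨k, F, hF⟩ := Coinduced.exists_injective (A := A) hE Y
    have hC := (((hJ (t + 2)).of_equiv (homCoinducedEquiv R M E)).pi k).of_equiv (homPiEquiv M k)
    let q := (LinearMap.range F).mkQ
    have hFq : Function.Exact F q := LinearMap.exact_map_mkQ_range F
    have hq : Function.Surjective q := Submodule.mkQ_surjective _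
    let P := postcompLinear M q
    have hP : Function.Exact (postcompLinear M F) P.rangeRestrict := fun x => by
      rw [← postcompLinear_exact M hF hFq x, Subtype.ext_iff]
      rfl
    refine HasAddCoresolution.left (Z := LinearMap.range P) (postcompLinear_injective M hF) hP
      P.surjective_rangeRestrict hC ?_
    · obtain _ | t := t
      · exact (ih (Y := _ ⧸ LinearMap.range F) fun i h1 h2 => by omega).of_injective
          (Submodule.injective_subtype _)
      · have hZ : HasAddCoresolution (Module.End A M)ᵐᵒᵖ J (t + 1 + 1)
            (M →ₗ[A] _ ⧸ LinearMap.range F) := by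
          refine ih fun i h1 h2 => ?_
          obtain ⟨i, rfl⟩ := Nat.exists_eq_add_of_le' h1
          exact ExtVanishes.of_covariant_right hF hFq hq (ExtVanishes.of_injective i)
            (hY _ (by omega) (by omega))
        have hs : LinearMap.range P = ⊤ := LinearMap.range_eq_top.mpr fun φ =>
          ExtVanishes.exists_lift hF hFq hq (hY 1 le_rfl (by omega)) φ
        exact hZ.of_equiv (LinearEquiv.ofTop _ hs)

end Coresolution

/-- Let `M` be a module over the Artin algebra `A` which is a cogenerator,
has `Ext^i_A(M,M) = 0` for `1 ≤ i ≤ n-1`, and admits an `add M`-coresolution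
`0 → A → M_0 → ⋯ → M_m → 0` of `A` which stays exact under `Hom_A(-,M)` and with
`pd_A(M_i) ≤ m` for each `i`, where `m < n`. Then for `Λ = End_A(M)` there is a finitely
generated injective right `Λ`-module (i.e. left `Λᵐᵒᵖ`-module) `J` of projective dimension
at most `m` with `J`-domdim `Λ_Λ ≥ n+1`. -/
theorem stmt10 (R : Type u) [CommRing R] [IsArtinianRing R]
    (A : Type u) [Ring A] [Algebra R A] [Module.Finite R A]
    (M : Type u) [AddCommGroup M] [Module A M] [Module.Finite A M]
    (n m : ℕ) (hmn : m < n)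
    (hcog : IsCogenerator A M)
    (hext : ∀ i : ℕ, 1 ≤ i → i ≤ n - 1 → ExtVanishes A M M i)
    (hres : ∃ (C : ℕ → ModuleCat.{u} A) (g : A →ₗ[A] C 0)
        (f : ∀ i, (C i : Type u) →ₗ[A] C (i+1)),
      (∀ i ≤ m, InAdd A M (C i)) ∧
      (∀ i, m < i → Subsingleton (C i)) ∧
      Function.Injective g ∧ Function.Exact g (f 0) ∧
      (∀ i, Function.Exact (f i) (f (i+1))) ∧
      Function.Surjective (fun φ : (C 0 : Type u) →ₗ[A] M => φ ∘ₗ g) ∧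
      Function.Exact (fun φ : (C 1 : Type u) →ₗ[A] M => φ ∘ₗ (f 0))
        (fun φ : (C 0 : Type u) →ₗ[A] M => φ ∘ₗ g) ∧
      (∀ i, Function.Exact (fun φ : (C (i+2) : Type u) →ₗ[A] M => φ ∘ₗ (f (i+1)))
        (fun φ : (C (i+1) : Type u) →ₗ[A] M => φ ∘ₗ (f i))) ∧
      (∀ i ≤ m, ProjDimLE A (C i) m)) :
    ∃ J : ModuleCat.{u} (Module.End A M)ᵐᵒᵖ,
      Module.Finite (Module.End A M)ᵐᵒᵖ J ∧ Module.Injective (Module.End A M)ᵐᵒᵖ J ∧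
      ProjDimLE (Module.End A M)ᵐᵒᵖ J m ∧
      IDomdimGE (Module.End A M)ᵐᵒᵖ J (Module.End A M)ᵐᵒᵖ (n + 1) := by
  obtain ⟨C, g, f, hC, hC0, -, -, -, hg, hgf, hf, hpd⟩ := hres
  obtain ⟨E, hEfin, hEinj, hE⟩ := exists_finite_injective_cogenerator R
  let _ : Module R M := Module.compHom M (algebraMap R A)
  have : IsScalarTower R A M := IsScalarTower.of_algebraMap_smul fun _ _ => rfl
  have : Module.Finite R M := Module.Finite.trans A M
  have : IsArtinianRing A := IsArtinianRing.of_finite R A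
  have : IsNoetherianRing A := IsNoetherianRing.of_finite R A
  let X := ∀ i : Fin (m + 1), C i
  have hXM : InAdd A M X := InAdd.pi fun i => hC i (by omega)
  have := hXM.finite
  have := DualHom.projective_self R M E hcog
  have hJ := (hXM.dualHom R M E).injective
  have hCJ (i : ℕ) : InAdd (Module.End A M)ᵐᵒᵖ (DualHom R A M E X) (DualHom R A M E (C i)) := by
    by_cases hi : i ≤ m
    · let j : Fin (m + 1) := ⟨i, by omega⟩
      refine InAdd.dualHom R M E (InAdd.of_retract
        (LinearMap.single A (fun i : Fin (m + 1) => C i) j) (LinearMap.proj j) ?_)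
      exact LinearMap.proj_comp_single_same A (fun i : Fin (m + 1) => C i) j
    · have := hC0 i (by omega)
      exact InAdd.of_subsingleton
  have hres (t : ℕ) : HasAddCoresolution (Module.End A M)ᵐᵒᵖ (DualHom R A M E X) t
      (DualHom R A M E A) :=
    HasAddCoresolution.of_exact (fun i => ModuleCat.of _ (DualHom R A M E (C i)))
      (DualHom.map R M E g) (fun i => DualHom.map R M E (f i)) hCJ (DualHom.map_injective R M E hg)
      (DualHom.map_exact R M E hgf) (fun i => DualHom.map_exact R M E (hf i)) t
  refine ⟨ModuleCat.of _ (DualHom R A M E X), DualHom.finite R M E, hJ,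
    DualHom.projDimLE R M E m (fun Y _ _ => ?_) fun i h1 h2 => ?_, ?_⟩
  · refine ExtVanishes.of_sum_eq_id (V := fun i : Fin (m + 1) => C i) LinearMap.proj
      (LinearMap.single A fun i : Fin (m + 1) => C i) ?_ fun i =>
      (hpd i (by omega)).extVanishes le_rfl
    exact LinearMap.ext fun x => by
      simpa [LinearMap.sum_apply] using LinearMap.sum_single_apply (fun i : Fin (m + 1) => C i) x
  · exact ExtVanishes.of_inAdd hXM (hext i h1 (by omega))
  · exact ((HasAddCoresolution.hom R M E hE hres n fun i h1 h2 =>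
      hext i h1 (by omega)).of_equiv (endOppositeEquiv M)).idomdimGE
end
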